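/- arXiv:1712.04262 — 2 statements merged into one kernel-verified Lean document; each statement's English description precedes it below -/
import Mathlib

section
/- Let K be a field, n > k ≥ 1 integers, R = K[x₁,…,xₙ], and I_{n,k} the ideal generated by all (k+1)-minors of the (k+1)×n Vandermonde matrix M_{n,k}. For i ≥ 1, the graded Betti numbers of R/I_{n,k} are given by β_{i,j}(R/I_{n,k}) = p^k_{i−1, j − k(k+1)/2} · C(n−1, k+i−1), where p^m_{r,s} is the number of tuples (a₁,…,a_m) ∈ ℕ^m with a₁+⋯+a_m = r and a₁+2a₂+⋯+m·a_m = s (with the convention p^m_{0,s} = δ_{0,s}). -/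
open MvPolynomial

/-- The `(k+1) × n` Vandermonde matrix of variables: the `(i,j)` entry is `xⱼ^i`
(rows indexed by `0,…,k`, columns by the variables `x₁,…,xₙ`). -/
noncomputable def vandermondeMatrix (K : Type*) [Field K] (n k : ℕ) :
    Matrix (Fin (k + 1)) (Fin n) (MvPolynomial (Fin n) K) :=
  Matrix.of fun i j => (X j : MvPolynomial (Fin n) K) ^ (i : ℕ)

/-- The ideal generated by all maximal (i.e. `(k+1)`-size) minors of the
Vandermonde matrix `vandermondeMatrix K n k`. -/
noncomputable def vanIdeal (K : Type*) [Field K] (n k : ℕ) :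
    Ideal (MvPolynomial (Fin n) K) :=
  Ideal.span { d | ∃ g : Fin (k + 1) ↪ Fin n,
    d = ((vandermondeMatrix K n k).submatrix id g).det }

/-- Index type for the free module in homological degree `i` of a graded free resolution
with graded Betti numbers `β`: one basis element of internal degree `j` for each
`t < β i j`. -/
def bettiBasis (β : ℕ → ℕ → ℕ) (i : ℕ) : Type := {p : ℕ × ℕ // p.2 < β i p.1}

/-- `β` is the table of graded Betti numbers of a minimal graded free resolution of
`R ⧸ I` over `R = K[x₁,…,xₙ]`, i.e. `β i j = β_{i,j}(R ⧸ I) = dim_K Tor_i(R ⧸ I, K)_j`. -/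
def IsMinimalFreeResolution (K : Type*) [Field K] {n : ℕ}
    (I : Ideal (MvPolynomial (Fin n) K)) (β : ℕ → ℕ → ℕ) : Prop :=
  ∃ (d : ∀ i : ℕ, (bettiBasis β (i + 1) →₀ MvPolynomial (Fin n) K)
        →ₗ[MvPolynomial (Fin n) K] (bettiBasis β i →₀ MvPolynomial (Fin n) K))
    (ε : (bettiBasis β 0 →₀ MvPolynomial (Fin n) K)
        →ₗ[MvPolynomial (Fin n) K] (MvPolynomial (Fin n) K ⧸ I)),
    -- exactness: a free resolution of `R ⧸ I`
    Function.Surjective ε ∧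
    LinearMap.ker ε = LinearMap.range (d 0) ∧
    (∀ i, LinearMap.ker (d i) = LinearMap.range (d (i + 1))) ∧
    -- the differentials are graded: the matrix entry from a generator of internal degree
    -- `j` to a generator of internal degree `j'` is homogeneous of degree `j - j'`
    (∀ i, ∀ b : bettiBasis β (i + 1), ∀ b' : bettiBasis β i,
      (d i (Finsupp.single b 1)) b' = 0 ∨
      (b'.1.1 ≤ b.1.1 ∧ ((d i (Finsupp.single b 1)) b').IsHomogeneous (b.1.1 - b'.1.1))) ∧
    -- minimality: all entries of the differentials lie in the irrelevant maximal ideal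
    (∀ i, ∀ b : bettiBasis β (i + 1), ∀ b' : bettiBasis β i,
      constantCoeff ((d i (Finsupp.single b 1)) b') = 0) ∧
    -- the augmentation is graded: a generator of internal degree `j` maps into the
    -- degree `j` component of `R ⧸ I`
    (∀ b : bettiBasis β 0, ε (Finsupp.single b 1) ∈
      (MvPolynomial.homogeneousSubmodule (Fin n) K b.1.1).map
        (Ideal.Quotient.mkₐ K I).toLinearMap)

/-- `pCount m i j = p^m_{i,j}`: the number of tuples `(a₁,…,a_m)` of nonnegative integers
with `a₁ + ⋯ + a_m = i` and `a₁ + 2·a₂ + ⋯ + m·a_m = j`. -/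
noncomputable def pCount (m i : ℕ) (j : ℤ) : ℕ :=
  Nat.card {a : Fin m → ℕ // (∑ t, a t) = i ∧
    (∑ t : Fin m, ((t.val : ℤ) + 1) * (a t : ℤ)) = j}

section GradedFreeModules

variable {σ K : Type*} [Field K] {B C : Type*}

/-- The `K`-basis of a free module over a polynomial ring formed by the monomial multiples of
the free generators. -/
noncomputable def termBasis (σ K B : Type*) [Field K] :
    Module.Basis (Σ _ : B, σ →₀ ℕ) K (B →₀ MvPolynomial σ K) :=
  Finsupp.basis fun _ => basisMonomials σ K

lemma termBasis_apply (b : B) (α : σ →₀ ℕ) :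
    termBasis σ K B ⟨b, α⟩ = Finsupp.single b (monomial α 1) := by
  simp [termBasis, Finsupp.coe_basis]

lemma termBasis_repr (z : B →₀ MvPolynomial σ K) (x : Σ _ : B, σ →₀ ℕ) :
    (termBasis σ K B).repr z x = coeff x.2 (z x.1) := by
  rw [termBasis, Finsupp.basis_repr]
  rfl

lemma termBasis_eq_smul (b : B) (α : σ →₀ ℕ) :
    termBasis σ K B ⟨b, α⟩ =
      (monomial α (1 : K)) • Finsupp.single b (1 : MvPolynomial σ K) := by
  simp [termBasis_apply]

lemma mem_span_termBasis_image {s : Set (Σ _ : B, σ →₀ ℕ)} {z : B →₀ MvPolynomial σ K} :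
    z ∈ Submodule.span K (termBasis σ K B '' s) ↔ ∀ b α, coeff α (z b) ≠ 0 → ⟨b, α⟩ ∈ s := by
  rw [Module.Basis.mem_span_image]
  constructor
  · intro h b α hc
    exact h (by simpa [termBasis_repr] using hc)
  · rintro h ⟨b, α⟩ hx
    exact h b α (by simpa [termBasis_repr] using hx)

/-- The span of the terms whose degree lies in `S`. -/
noncomputable def degreePart (deg : B → ℕ) (S : Set ℕ) : Submodule K (B →₀ MvPolynomial σ K) :=
  Submodule.span K (termBasis σ K B '' {x | x.2.degree + deg x.1 ∈ S})

lemma mem_degreePart {deg : B → ℕ} {S : Set ℕ} {z : B →₀ MvPolynomial σ K} :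
    z ∈ degreePart deg S ↔ ∀ b α, coeff α (z b) ≠ 0 → α.degree + deg b ∈ S :=
  mem_span_termBasis_image

lemma degreePart_mono {deg : B → ℕ} {S T : Set ℕ} (h : S ⊆ T) :
    degreePart (σ := σ) (K := K) deg S ≤ degreePart deg T := by
  intro z hz
  rw [mem_degreePart] at hz ⊢
  exact fun b α hb => h (hz b α hb)

lemma exists_add_of_degreePart (deg : B → ℕ) (S : Set ℕ) (z : B →₀ MvPolynomial σ K) :
    ∃ u ∈ degreePart (σ := σ) (K := K) deg S, ∃ v ∈ degreePart (σ := σ) (K := K) deg Sᶜ,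
      u + v = z := by
  rw [← Submodule.mem_sup, degreePart, degreePart, ← Submodule.span_union, ← Set.image_union]
  have : {x : Σ _ : B, σ →₀ ℕ | x.2.degree + deg x.1 ∈ S} ∪
      {x | x.2.degree + deg x.1 ∈ Sᶜ} = Set.univ := by
    ext x; simp [em]
  rw [this, Set.image_univ, Module.Basis.span_eq]
  trivial

lemma eq_zero_of_mem_degreePart {deg : B → ℕ} {S : Set ℕ} {z : B →₀ MvPolynomial σ K}
    (h : z ∈ degreePart deg S) (h' : z ∈ degreePart deg Sᶜ) : z = 0 := by
  rw [mem_degreePart] at h h'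
  ext b α
  by_contra hc
  exact h' b α hc (h b α hc)

lemma monomial_smul_mem_degreePart {deg : B → ℕ} {j : ℕ} {z : B →₀ MvPolynomial σ K}
    (h : z ∈ degreePart deg {j}) (α : σ →₀ ℕ) (r : K) :
    monomial α r • z ∈ degreePart deg {α.degree + j} := by
  rw [mem_degreePart] at h ⊢
  intro b β hb
  rw [Finsupp.smul_apply, smul_eq_mul, coeff_monomial_mul'] at hb
  split_ifs at hb with hle
  · have := h b (β - α) (right_ne_zero_of_mul hb)
    simp only [Set.mem_singleton_iff] at this ⊢
    have e : α.degree + (β - α).degree = β.degree := by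
      rw [← map_add, add_tsub_cancel_of_le hle]
    omega
  · exact absurd rfl hb

lemma single_one_mem_degreePart (deg : B → ℕ) (b : B) :
    (Finsupp.single b 1 : B →₀ MvPolynomial σ K) ∈ degreePart deg {deg b} := by
  rw [mem_degreePart]
  classical
  intro c α hc
  rw [Finsupp.single_apply] at hc
  split_ifs at hc with h
  · subst h
    rw [coeff_one] at hc
    split_ifs at hc with h
    · simp [← h]
    · exact absurd rfl hc
  · simp at hc

/-- A linear map of graded free modules that preserves degrees. -/
def IsGradedMap (degB : B → ℕ) (degC : C → ℕ)
    (f : (B →₀ MvPolynomial σ K) →ₗ[MvPolynomial σ K] (C →₀ MvPolynomial σ K)) : Prop :=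
  ∀ b, f (Finsupp.single b 1) ∈ degreePart degC {degB b}

lemma IsGradedMap.map_mem {degB : B → ℕ} {degC : C → ℕ}
    {f : (B →₀ MvPolynomial σ K) →ₗ[MvPolynomial σ K] (C →₀ MvPolynomial σ K)}
    (hf : IsGradedMap degB degC f) {S : Set ℕ} {z : B →₀ MvPolynomial σ K}
    (hz : z ∈ degreePart degB S) : f z ∈ degreePart degC S := by
  induction hz using Submodule.span_induction with
  | mem x hx =>
    obtain ⟨⟨b, α⟩, hb, rfl⟩ := hx
    rw [termBasis_eq_smul, map_smul]
    exact degreePart_mono (by simpa using hb) (monomial_smul_mem_degreePart (hf b) α 1)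
  | zero => simp
  | add x y _ _ hx hy => rw [map_add]; exact add_mem hx hy
  | smul a x _ hx =>
    rw [LinearMap.map_smul_of_tower]
    exact Submodule.smul_mem _ _ hx

lemma IsGradedMap.comp {D : Type*} {degB : B → ℕ} {degC : C → ℕ} {degD : D → ℕ}
    {g : (C →₀ MvPolynomial σ K) →ₗ[MvPolynomial σ K] (D →₀ MvPolynomial σ K)}
    {f : (B →₀ MvPolynomial σ K) →ₗ[MvPolynomial σ K] (C →₀ MvPolynomial σ K)}
    (hg : IsGradedMap degC degD g) (hf : IsGradedMap degB degC f) :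
    IsGradedMap degB degD (g ∘ₗ f) :=
  fun b => hg.map_mem (hf b)

lemma IsGradedMap.exists_mem_degreePart {degB : B → ℕ} {degC : C → ℕ}
    {f : (B →₀ MvPolynomial σ K) →ₗ[MvPolynomial σ K] (C →₀ MvPolynomial σ K)}
    (hf : IsGradedMap degB degC f) {S : Set ℕ} {y : C →₀ MvPolynomial σ K}
    (hy : y ∈ degreePart degC S) (hr : y ∈ LinearMap.range f) :
    ∃ z ∈ degreePart (σ := σ) (K := K) degB S, f z = y := by
  obtain ⟨z, rfl⟩ := hr
  obtain ⟨u, hu, v, hv, rfl⟩ := exists_add_of_degreePart degB S z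
  refine ⟨u, hu, ?_⟩
  have : f v = 0 := eq_zero_of_mem_degreePart (S := S)
    (by simpa using sub_mem hy (hf.map_mem hu)) (hf.map_mem hv)
  rw [map_add, this, add_zero]

/-- The submodule of vectors all of whose entries have zero constant coefficient. -/
def irrelevantPart (σ K B : Type*) [Field K] :
    Submodule (MvPolynomial σ K) (B →₀ MvPolynomial σ K) where
  carrier := {z | ∀ b, constantCoeff (z b) = 0}
  add_mem' := by
    intro x y hx hy b
    simp [hx b, hy b]
  zero_mem' := by simp
  smul_mem' := by
    intro r x hx b
    simp [hx b]

lemma mem_irrelevantPart {z : B →₀ MvPolynomial σ K} :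
    z ∈ irrelevantPart σ K B ↔ ∀ b, constantCoeff (z b) = 0 := Iff.rfl

lemma range_le_irrelevantPart
    {f : (B →₀ MvPolynomial σ K) →ₗ[MvPolynomial σ K] (C →₀ MvPolynomial σ K)}
    (hf : ∀ b, f (Finsupp.single b 1) ∈ irrelevantPart σ K C) :
    LinearMap.range f ≤ irrelevantPart σ K C := by
  rintro _ ⟨z, rfl⟩
  induction z using Finsupp.induction_linear with
  | zero => simp
  | add x y hx hy => rw [map_add]; exact add_mem hx hy
  | single b r =>
    rw [← mul_one r, ← smul_eq_mul, ← Finsupp.smul_single, map_smul]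
    exact Submodule.smul_mem _ _ (hf b)

lemma map_apply_eq_sum
    (f : (B →₀ MvPolynomial σ K) →ₗ[MvPolynomial σ K] (C →₀ MvPolynomial σ K))
    (z : B →₀ MvPolynomial σ K) :
    f z = z.sum fun b r => r • f (Finsupp.single b 1) := by
  conv_lhs => rw [← Finsupp.sum_single z, map_finsuppSum]
  refine Finsupp.sum_congr fun b _ => ?_
  rw [← map_smul, Finsupp.smul_single, smul_eq_mul, mul_one]

lemma degree_lt_of_entry_ne_zero {deg : B → ℕ} {j : ℕ} {z : B →₀ MvPolynomial σ K}
    (hz : z ∈ degreePart deg {j}) {b : B} (hc : constantCoeff (z b) = 0) (hb : z b ≠ 0) :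
    deg b < j := by
  obtain ⟨α, hα⟩ := ne_zero_iff.mp hb
  have h := mem_degreePart.mp hz b α hα
  have : α ≠ 0 := by
    rintro rfl
    exact hα hc
  have := (Finsupp.degree_eq_zero_iff α).not.mpr this
  simp only [Set.mem_singleton_iff] at h
  omega

lemma surjective_of_sub_mem_irrelevantPart {deg : B → ℕ}
    {f : (B →₀ MvPolynomial σ K) →ₗ[MvPolynomial σ K] (B →₀ MvPolynomial σ K)}
    (hf : IsGradedMap deg deg f)
    (h : ∀ b, f (Finsupp.single b 1) - Finsupp.single b 1 ∈ irrelevantPart σ K B) :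
    Function.Surjective f := by
  have key : ∀ d b, deg b = d → Finsupp.single b 1 ∈ LinearMap.range f := by
    intro d
    induction d using Nat.strong_induction_on with
    | _ d ih =>
      intro b hb
      set w := f (Finsupp.single b 1) - Finsupp.single b 1 with hw
      have hwd : w ∈ degreePart deg {deg b} := sub_mem (hf b) (single_one_mem_degreePart deg b)
      have hwr : w ∈ LinearMap.range f := by
        rw [← Finsupp.sum_single w]
        refine Submodule.sum_mem _ fun c hc => ?_
        rw [← mul_one (w c), ← smul_eq_mul, ← Finsupp.smul_single]
        refine Submodule.smul_mem _ _ (ih (deg c) ?_ c rfl)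
        rw [← hb]
        exact degree_lt_of_entry_ne_zero hwd (h b c) (Finsupp.mem_support_iff.mp hc)
      have : Finsupp.single b 1 = f (Finsupp.single b 1) - w := by rw [hw]; abel
      rw [this]
      exact sub_mem ⟨_, rfl⟩ hwr
  intro z
  change z ∈ LinearMap.range f
  rw [← Finsupp.sum_single z]
  refine Submodule.sum_mem _ fun c _ => ?_
  rw [← mul_one (z c), ← smul_eq_mul, ← Finsupp.smul_single]
  exact Submodule.smul_mem _ _ (key _ c rfl)

lemma injective_of_sub_mem_irrelevantPart {deg : B → ℕ}
    {f : (B →₀ MvPolynomial σ K) →ₗ[MvPolynomial σ K] (B →₀ MvPolynomial σ K)}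
    (hf : IsGradedMap deg deg f)
    (h : ∀ b, f (Finsupp.single b 1) - Finsupp.single b 1 ∈ irrelevantPart σ K B) :
    Function.Injective f := by
  classical
  rw [injective_iff_map_eq_zero]
  intro z hz
  by_contra hne
  obtain ⟨b, hb, hmax⟩ := z.support.exists_max_image deg (Finsupp.support_nonempty_iff.mpr hne)
  refine Finsupp.mem_support_iff.mp hb ?_
  have h1 : f z - z = z.sum fun b r => r • (f (Finsupp.single b 1) - Finsupp.single b 1) := by
    simp only [smul_sub, Finsupp.sum_sub, ← map_apply_eq_sum]
    congr 1
    simp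
  have h2 : (f z - z) b = 0 := by
    rw [h1, Finsupp.sum, Finsupp.finsetSum_apply]
    refine Finset.sum_eq_zero fun c hc => ?_
    rw [Finsupp.smul_apply, smul_eq_mul]
    by_contra hcb
    have := degree_lt_of_entry_ne_zero
      (sub_mem (hf c) (single_one_mem_degreePart deg c)) (h c b) (right_ne_zero_of_mul hcb)
    exact absurd (hmax c hc) (by omega)
  simpa [hz] using h2

lemma degree_eq_of_isHomogeneous {p : MvPolynomial σ K} {j : ℕ} (h : p.IsHomogeneous j)
    {α : σ →₀ ℕ} (hα : coeff α p ≠ 0) : α.degree = j := by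
  rw [Finsupp.degree_eq_weight_one]
  exact h hα

open scoped Classical in
lemma constantCoeff_matrix_mul_eq_one {degB : B → ℕ} {degC : C → ℕ}
    {f : (B →₀ MvPolynomial σ K) →ₗ[MvPolynomial σ K] (C →₀ MvPolynomial σ K)}
    {g : (C →₀ MvPolynomial σ K) →ₗ[MvPolynomial σ K] (B →₀ MvPolynomial σ K)}
    (hf : IsGradedMap degB degC f)
    (hgf : ∀ b, g (f (Finsupp.single b 1)) - Finsupp.single b 1 ∈ irrelevantPart σ K B)
    (j : ℕ) [Fintype {b // degB b = j}] [Fintype {c // degC c = j}] :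
    (Matrix.of fun (b : {b // degB b = j}) (c : {c // degC c = j}) =>
      constantCoeff (f (Finsupp.single b.1 1) c.1)) *
    (Matrix.of fun (c : {c // degC c = j}) (b : {b // degB b = j}) =>
      constantCoeff (g (Finsupp.single c.1 1) b.1)) = 1 := by
  ext b b'
  have h1 := hgf b.1 b'.1
  rw [map_apply_eq_sum g, Finsupp.sub_apply, map_sub, sub_eq_zero, Finsupp.sum,
    Finsupp.finsetSum_apply, map_sum] at h1
  have h2 : (1 : Matrix {b // degB b = j} {b // degB b = j} K) b b' =
      constantCoeff ((Finsupp.single b.1 1 : B →₀ MvPolynomial σ K) b'.1) := by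
    rw [Matrix.one_apply, Finsupp.single_apply]
    by_cases h : b = b'
    · simp [h]
    · simp [h, Subtype.coe_injective.ne_iff.mpr h]
  rw [h2, ← h1, Matrix.mul_apply]
  simp only [Matrix.of_apply, Finsupp.smul_apply, smul_eq_mul, map_mul]
  set F : C → K := fun c => constantCoeff (f (Finsupp.single b.1 1) c) *
    constantCoeff (g (Finsupp.single c 1) b'.1) with hF
  have h3 : ∑ c : {c // degC c = j}, F c =
      ∑ c ∈ Finset.univ.map (Function.Embedding.subtype fun c => degC c = j), F c := by
    rw [Finset.sum_map]
    rfl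
  refine h3.trans ((Finset.sum_subset Finset.subset_union_left ?_).trans
    (Finset.sum_subset (Finset.subset_union_right (s₂ := (f (Finsupp.single b.1 1)).support))
      ?_).symm)
  · intro c _ hc
    refine mul_eq_zero_of_left ?_ _
    by_contra hne
    have := mem_degreePart.mp (hf b.1) c 0 hne
    refine hc (Finset.mem_map.mpr ⟨⟨c, ?_⟩, Finset.mem_univ _, rfl⟩)
    simpa [b.2] using this
  · intro c _ hc
    simp [hF, Finsupp.notMem_support_iff.mp hc]

/-- Mutually inverse (modulo the irrelevant ideal) graded maps force equal numbers of generators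
in each degree. -/
lemma card_degree_eq {degB : B → ℕ} {degC : C → ℕ}
    {f : (B →₀ MvPolynomial σ K) →ₗ[MvPolynomial σ K] (C →₀ MvPolynomial σ K)}
    {g : (C →₀ MvPolynomial σ K) →ₗ[MvPolynomial σ K] (B →₀ MvPolynomial σ K)}
    (hf : IsGradedMap degB degC f) (hg : IsGradedMap degC degB g)
    (hgf : ∀ b, g (f (Finsupp.single b 1)) - Finsupp.single b 1 ∈ irrelevantPart σ K B)
    (hfg : ∀ c, f (g (Finsupp.single c 1)) - Finsupp.single c 1 ∈ irrelevantPart σ K C)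
    (j : ℕ) [Finite {b // degB b = j}] [Finite {c // degC c = j}] :
    Nat.card {b // degB b = j} = Nat.card {c // degC c = j} := by
  classical
  have := Fintype.ofFinite {b // degB b = j}
  have := Fintype.ofFinite {c // degC c = j}
  rw [Nat.card_eq_fintype_card, Nat.card_eq_fintype_card]
  exact Matrix.square_of_invertible _ _
    (by convert constantCoeff_matrix_mul_eq_one hf hgf j)
    (by convert constantCoeff_matrix_mul_eq_one hg hfg j)

/-- Two minimal graded free covers of submodules with the same image are isomorphic. -/
lemma exists_equiv_of_minimal_covers {X : Type*} [AddCommGroup X] [Module (MvPolynomial σ K) X]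
    {degB : B → ℕ} {degC : C → ℕ}
    (p : (B →₀ MvPolynomial σ K) →ₗ[MvPolynomial σ K] X)
    (q : (C →₀ MvPolynomial σ K) →ₗ[MvPolynomial σ K] X)
    (hp : LinearMap.ker p ≤ irrelevantPart σ K B) (hq : LinearMap.ker q ≤ irrelevantPart σ K C)
    (hpq : ∀ b, ∃ w ∈ degreePart (σ := σ) (K := K) degC {degB b}, q w = p (Finsupp.single b 1))
    (hqp : ∀ c, ∃ w ∈ degreePart (σ := σ) (K := K) degB {degC c}, p w = q (Finsupp.single c 1))
    (finB : ∀ j, Finite {b // degB b = j}) (finC : ∀ j, Finite {c // degC c = j}) :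
    (∃ Φ : (B →₀ MvPolynomial σ K) ≃ₗ[MvPolynomial σ K] (C →₀ MvPolynomial σ K),
      IsGradedMap degB degC Φ.toLinearMap ∧ q ∘ₗ Φ.toLinearMap = p) ∧
    ∀ j, Nat.card {b // degB b = j} = Nat.card {c // degC c = j} := by
  choose u hu hqu using hpq
  choose v hv hpv using hqp
  set f := Finsupp.linearCombination (MvPolynomial σ K) u with hf
  set g := Finsupp.linearCombination (MvPolynomial σ K) v with hg
  have fgr : IsGradedMap degB degC f := fun b => by simpa [hf] using hu b
  have ggr : IsGradedMap degC degB g := fun c => by simpa [hg] using hv c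
  have hqf : q ∘ₗ f = p := by
    ext b
    simp [hf, hqu]
  have hpg : p ∘ₗ g = q := by
    ext c
    simp [hg, hpv]
  have hqf' := fun z => LinearMap.congr_fun hqf z
  have hpg' := fun z => LinearMap.congr_fun hpg z
  simp only [LinearMap.comp_apply] at hqf' hpg'
  have hgf : ∀ b, (g ∘ₗ f) (Finsupp.single b 1) - Finsupp.single b 1 ∈ irrelevantPart σ K B :=
    fun b => hp (by rw [LinearMap.mem_ker, map_sub, LinearMap.comp_apply, hpg', hqf', sub_self])
  have hfg : ∀ c, (f ∘ₗ g) (Finsupp.single c 1) - Finsupp.single c 1 ∈ irrelevantPart σ K C :=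
    fun c => hq (by rw [LinearMap.mem_ker, map_sub, LinearMap.comp_apply, hqf', hpg', sub_self])
  have hbij : Function.Bijective f :=
    ⟨Function.Injective.of_comp (f := g)
      (injective_of_sub_mem_irrelevantPart (ggr.comp fgr) hgf),
     Function.Surjective.of_comp (g := g)
      (surjective_of_sub_mem_irrelevantPart (fgr.comp ggr) hfg)⟩
  exact ⟨⟨LinearEquiv.ofBijective f hbij, fgr, hqf⟩,
    fun j => card_degree_eq fgr ggr hgf hfg j⟩

/-- A minimal graded free resolution of `R ⧸ I` with generators indexed by the types `B i`. -/
structure IsMinimalGradedResolution (I : Ideal (MvPolynomial σ K)) (B : ℕ → Type*)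
    (deg : ∀ i, B i → ℕ)
    (d : ∀ i, (B (i + 1) →₀ MvPolynomial σ K) →ₗ[MvPolynomial σ K] (B i →₀ MvPolynomial σ K))
    (ε : (B 0 →₀ MvPolynomial σ K) →ₗ[MvPolynomial σ K] (MvPolynomial σ K ⧸ I)) : Prop where
  surjective : Function.Surjective ε
  ker_augmentation : LinearMap.ker ε = LinearMap.range (d 0)
  exact : ∀ i, LinearMap.ker (d i) = LinearMap.range (d (i + 1))
  graded : ∀ i, IsGradedMap (deg (i + 1)) (deg i) (d i)
  minimal : ∀ i b, d i (Finsupp.single b 1) ∈ irrelevantPart σ K (B i)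
  graded_augmentation : ∀ b, ∃ r : MvPolynomial σ K, r.IsHomogeneous (deg 0 b) ∧
    ε (Finsupp.single b 1) = Ideal.Quotient.mk I r
  finite : ∀ i j, Finite {b : B i // deg i b = j}

namespace IsMinimalGradedResolution

variable {I : Ideal (MvPolynomial σ K)} {B C : ℕ → Type*} {degB : ∀ i, B i → ℕ}
  {degC : ∀ i, C i → ℕ}
  {d : ∀ i, (B (i + 1) →₀ MvPolynomial σ K) →ₗ[MvPolynomial σ K] (B i →₀ MvPolynomial σ K)}
  {δ : ∀ i, (C (i + 1) →₀ MvPolynomial σ K) →ₗ[MvPolynomial σ K] (C i →₀ MvPolynomial σ K)}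
  {ε : (B 0 →₀ MvPolynomial σ K) →ₗ[MvPolynomial σ K] (MvPolynomial σ K ⧸ I)}
  {η : (C 0 →₀ MvPolynomial σ K) →ₗ[MvPolynomial σ K] (MvPolynomial σ K ⧸ I)}

lemma ker_le (h : IsMinimalGradedResolution I B degB d ε) (i : ℕ) :
    LinearMap.ker (d i) ≤ irrelevantPart σ K (B (i + 1)) :=
  h.exact i ▸ range_le_irrelevantPart (h.minimal (i + 1))

lemma ker_augmentation_le (h : IsMinimalGradedResolution I B degB d ε) :
    LinearMap.ker ε ≤ irrelevantPart σ K (B 0) :=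
  h.ker_augmentation ▸ range_le_irrelevantPart (h.minimal 0)

lemma exists_homogeneous_preimage (h : IsMinimalGradedResolution I B degB d ε)
    (hI : ∀ r ∈ I, ∀ j, homogeneousComponent j r ∈ I) {r : MvPolynomial σ K} {j : ℕ}
    (hr : r.IsHomogeneous j) :
    ∃ w ∈ degreePart (σ := σ) (K := K) (degB 0) {j}, ε w = Ideal.Quotient.mk I r := by
  choose s hs hε using h.graded_augmentation
  set e : (B 0 →₀ MvPolynomial σ K) →ₗ[MvPolynomial σ K] (Unit →₀ MvPolynomial σ K) :=
    Finsupp.linearCombination (MvPolynomial σ K) fun b => Finsupp.single () (s b) with he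
  have egr : IsGradedMap (degB 0) (fun _ => 0) e := by
    intro b
    rw [mem_degreePart]
    intro _ α hα
    simp only [he, Finsupp.linearCombination_single, one_smul, Finsupp.single_eq_same] at hα
    simpa using degree_eq_of_isHomogeneous (hs b) hα
  have hεe : ∀ z, ε z = Ideal.Quotient.mk I (e z ()) := by
    intro z
    have : ε = (Submodule.mkQ I) ∘ₗ (Finsupp.lapply ()) ∘ₗ e := by
      ext b
      simp [he, hε]
    rw [this]
    rfl
  obtain ⟨w, hw⟩ := h.surjective (Ideal.Quotient.mk I r)
  obtain ⟨u, hu, v, hv, rfl⟩ := exists_add_of_degreePart (degB 0) {j} w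
  refine ⟨u, hu, ?_⟩
  rw [hεe, Ideal.Quotient.eq] at hw
  rw [hεe, Ideal.Quotient.eq]
  have hu' := mem_degreePart.mp (egr.map_mem hu) ()
  have hv' := mem_degreePart.mp (egr.map_mem hv) ()
  convert hI _ hw j using 1
  ext α
  rw [coeff_homogeneousComponent, map_add e, Finsupp.add_apply, coeff_sub, coeff_sub, coeff_add]
  split_ifs with hα
  · have : coeff α (e v ()) = 0 := by
      by_contra hne
      exact hv' α hne (by simpa using hα)
    rw [this, add_zero]
  · have h1 : coeff α (e u ()) = 0 := by
      by_contra hne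
      exact hα (by simpa using hu' α hne)
    have h2 : coeff α r = 0 := by
      by_contra hne
      exact hα (degree_eq_of_isHomogeneous hr hne)
    rw [h1, h2, sub_zero]

/-- The graded Betti numbers do not depend on the minimal graded free resolution. -/
theorem card_degree_eq (h : IsMinimalGradedResolution I B degB d ε)
    (h' : IsMinimalGradedResolution I C degC δ η)
    (hI : ∀ r ∈ I, ∀ j, homogeneousComponent j r ∈ I) (i j : ℕ) :
    Nat.card {b : B i // degB i b = j} = Nat.card {c : C i // degC i c = j} := by
  have key : ∀ i, (∃ Φ : (B i →₀ MvPolynomial σ K) ≃ₗ[MvPolynomial σ K] (C i →₀ MvPolynomial σ K),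
      IsGradedMap (degB i) (degC i) Φ.toLinearMap ∧
        ∀ z, z ∈ LinearMap.range (d i) ↔ Φ z ∈ LinearMap.range (δ i)) ∧
      ∀ j, Nat.card {b : B i // degB i b = j} = Nat.card {c : C i // degC i c = j} := by
    intro i
    induction i with
    | zero =>
      obtain ⟨⟨Φ, hΦ, hc⟩, hcard⟩ := exists_equiv_of_minimal_covers ε η h.ker_augmentation_le
        h'.ker_augmentation_le (degB := degB 0) (degC := degC 0)
        (fun b => by
          obtain ⟨r, hr, e⟩ := h.graded_augmentation b
          rw [e]
          exact h'.exists_homogeneous_preimage hI hr)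
        (fun c => by
          obtain ⟨r, hr, e⟩ := h'.graded_augmentation c
          rw [e]
          exact h.exists_homogeneous_preimage hI hr) (h.finite 0) (h'.finite 0)
      refine ⟨⟨Φ, hΦ, fun z => ?_⟩, hcard⟩
      rw [← h.ker_augmentation, ← h'.ker_augmentation, LinearMap.mem_ker, LinearMap.mem_ker, ← hc]
      rfl
    | succ i ih =>
      obtain ⟨⟨Ψ, hΨ, hr⟩, -⟩ := ih
      have pgr := hΨ.comp (h.graded i)
      obtain ⟨⟨Φ, hΦ, hc⟩, hcard⟩ := exists_equiv_of_minimal_covers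
        (Ψ.toLinearMap ∘ₗ d i) (δ i) (degB := degB (i + 1)) (degC := degC (i + 1))
        (by
          rw [LinearMap.ker_comp_of_ker_eq_bot _ Ψ.ker]
          exact h.ker_le i)
        (h'.ker_le i)
        (fun b => (h'.graded i).exists_mem_degreePart (pgr b) ((hr _).mp ⟨_, rfl⟩))
        (fun c => pgr.exists_mem_degreePart (h'.graded i c) (by
          obtain ⟨w, hw⟩ := (hr (Ψ.symm (δ i (Finsupp.single c 1)))).mpr (by simp)
          exact ⟨w, by simp [hw]⟩)) (h.finite (i + 1)) (h'.finite (i + 1))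
      refine ⟨⟨Φ, hΦ, fun z => ?_⟩, hcard⟩
      have := LinearMap.congr_fun hc z
      rw [← h.exact, ← h'.exact, LinearMap.mem_ker, LinearMap.mem_ker]
      simp only [LinearMap.comp_apply, LinearEquiv.coe_coe] at this
      rw [this, LinearEquiv.map_eq_zero_iff]
  exact (key i).2 j

end IsMinimalGradedResolution

end GradedFreeModules

section Combinatorics

variable {m k : ℕ}

/-- The number of elements of `J` below `j`. -/
def rankBelow (J : Finset (Fin m)) (j : Fin m) : ℕ := (J.filter (· < j)).card

lemma rankBelow_mono (J : Finset (Fin m)) {i j : Fin m} (h : i ≤ j) :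
    rankBelow J i ≤ rankBelow J j :=
  Finset.card_le_card fun x hx => by
    rw [Finset.mem_filter] at hx ⊢
    exact ⟨hx.1, hx.2.trans_le h⟩

lemma rankBelow_lt {J : Finset (Fin m)} {i j : Fin m} (hi : i ∈ J) (h : i < j) :
    rankBelow J i < rankBelow J j := by
  refine Finset.card_lt_card (Finset.ssubset_iff_of_subset ?_ |>.mpr ⟨i, ?_, ?_⟩)
  · intro x hx
    rw [Finset.mem_filter] at hx ⊢
    exact ⟨hx.1, hx.2.trans h⟩
  · simp [hi, h]
  · simp

lemma rankBelow_lt_card {J : Finset (Fin m)} {j : Fin m} (hj : j ∈ J) :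
    rankBelow J j < J.card :=
  Finset.card_lt_card (Finset.filter_ssubset.mpr ⟨j, hj, lt_irrefl j⟩)

lemma rankBelow_congr {J J' : Finset (Fin m)} {j : Fin m} (h : ∀ i < j, i ∈ J ↔ i ∈ J') :
    rankBelow J j = rankBelow J' j := by
  unfold rankBelow
  congr 1
  ext i
  simp only [Finset.mem_filter]
  exact ⟨fun hi => ⟨(h i hi.2).mp hi.1, hi.2⟩, fun hi => ⟨(h i hi.2).mpr hi.1, hi.2⟩⟩

lemma rankBelow_erase_of_le (J : Finset (Fin m)) {i j : Fin m} (h : j ≤ i) :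
    rankBelow (J.erase i) j = rankBelow J j :=
  rankBelow_congr fun x hx => by simp [(hx.trans_le h).ne]

lemma rankBelow_erase_add_one {J : Finset (Fin m)} {i j : Fin m} (hi : i ∈ J) (h : i < j) :
    rankBelow (J.erase i) j + 1 = rankBelow J j := by
  unfold rankBelow
  rw [Finset.filter_erase, Finset.card_erase_add_one]
  simp [hi, h]

lemma exists_rankBelow_eq {J : Finset (Fin m)} {s : ℕ} (hs : s < J.card) :
    ∃ j ∈ J, rankBelow J j = s := by
  have hinj : Set.InjOn (rankBelow J) J := by
    intro x hx y hy hxy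
    rcases lt_trichotomy x y with h | h | h
    · exact absurd hxy (rankBelow_lt hx h).ne
    · exact h
    · exact absurd hxy (rankBelow_lt hy h).ne'
  have : J.image (rankBelow J) = Finset.range J.card := by
    refine Finset.eq_of_subset_of_card_le ?_ ?_
    · intro x hx
      obtain ⟨j, hj, rfl⟩ := Finset.mem_image.mp hx
      exact Finset.mem_range.mpr (rankBelow_lt_card hj)
    · rw [Finset.card_image_of_injOn hinj, Finset.card_range]
  have h : s ∈ J.image (rankBelow J) := this ▸ Finset.mem_range.mpr hs
  simpa using h

/-- The number of elements of `J` that are at least `c`. -/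
def countGE (J : Finset (Fin m)) (c : ℕ) : ℕ := (J.filter fun j => c ≤ j.val).card

lemma rankBelow_add_countGE (J : Finset (Fin m)) (j : Fin m) :
    rankBelow J j + countGE J j = J.card := by
  rw [← Finset.card_filter_add_card_filter_not (s := J) (· < j)]
  simp [rankBelow, countGE]

lemma countGE_succ_add_one {J : Finset (Fin m)} {j : Fin m} (hj : j ∈ J) :
    countGE J (j + 1) + 1 = countGE J j := by
  have : (J.filter fun i => j.val + 1 ≤ i.val) = (J.filter fun i => j.val ≤ i.val).erase j := by
    ext i
    simp only [Finset.mem_filter, Finset.mem_erase, ne_eq, Fin.ext_iff]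
    constructor
    · rintro ⟨h1, h2⟩
      exact ⟨by omega, h1, by omega⟩
    · rintro ⟨h1, h2, h3⟩
      exact ⟨h2, by omega⟩
  rw [countGE, this, Finset.card_erase_add_one (by simp [hj]), countGE]

lemma countGE_antitone (J : Finset (Fin m)) {c c' : ℕ} (h : c ≤ c') :
    countGE J c' ≤ countGE J c :=
  Finset.card_le_card fun x hx => by
    rw [Finset.mem_filter] at hx ⊢
    exact ⟨hx.1, h.trans hx.2⟩

lemma countGE_erase {J : Finset (Fin m)} {j : Fin m} (hj : j ∈ J) (c : ℕ) :
    countGE (J.erase j) c + (if c ≤ j.val then 1 else 0) = countGE J c := by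
  unfold countGE
  rw [Finset.filter_erase]
  split_ifs with h
  · rw [Finset.card_erase_add_one (by simp [hj, h])]
  · rw [Finset.erase_eq_of_notMem (by simp [h]), add_zero]

/-- The number of elements that are at least `t` in the multiset consisting of one copy of each
element of `Fin k` together with `a s` additional copies of each `s`. -/
def levelGE (a : Fin k → ℕ) (t : ℕ) : ℕ :=
  (k - t) + ∑ s with t ≤ s.val, a s

lemma levelGE_sub {a : Fin k → ℕ} {s : Fin k} (hs : a s ≠ 0) (t : ℕ) :
    levelGE (a - Pi.single s 1) t + (if t ≤ s.val then 1 else 0) = levelGE a t := by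
  have : a = (a - Pi.single s 1) + Pi.single s 1 := by
    ext x
    by_cases h : x = s
    · subst h
      simp
      omega
    · simp [h]
  conv_rhs => rw [this]
  simp only [levelGE, Pi.add_apply, Finset.sum_add_distrib, add_assoc]
  congr 2
  rw [Finset.sum_filter, Finset.sum_eq_single s (fun x _ hx => by simp [hx]) (by simp)]
  simp

lemma levelGE_antitone (a : Fin k → ℕ) {t t' : ℕ} (h : t ≤ t') : levelGE a t' ≤ levelGE a t := by
  unfold levelGE
  gcongr

lemma levelGE_zero (a : Fin k → ℕ) : levelGE a 0 = k + ∑ s, a s := by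
  simp [levelGE]

lemma levelGE_add_eq {a : Fin k → ℕ} {s : Fin k} (h : ∀ t < s, a t = 0) :
    levelGE a s + s = levelGE a 0 := by
  have : ∑ t with s.val ≤ t.val, a t = ∑ t, a t := by
    refine Finset.sum_subset (Finset.subset_univ _) fun t _ ht => h t ?_
    simpa using ht
  rw [levelGE_zero, levelGE, this]
  have := s.2
  omega

lemma levelGE_succ (a : Fin k → ℕ) (s : Fin k) :
    levelGE a (s + 1) + 1 + a s = levelGE a s := by
  have : Finset.univ.filter (fun t : Fin k => s.val ≤ t.val) =
      insert s (Finset.univ.filter (fun t : Fin k => s.val + 1 ≤ t.val)) := by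
    ext t
    simp only [Finset.mem_filter, Finset.mem_univ, true_and, Finset.mem_insert, Fin.ext_iff]
    omega
  rw [levelGE, levelGE, this, Finset.sum_insert (by simp)]
  have := s.2
  omega

lemma levelGE_add_le (a : Fin k → ℕ) {t : ℕ} (h : t ≤ k) : levelGE a t + t ≤ levelGE a 0 := by
  rw [levelGE_zero, levelGE]
  have : ∑ s with t ≤ s.val, a s ≤ ∑ s, a s :=
    Finset.sum_le_sum_of_subset (Finset.filter_subset _ _)
  omega

/-- The weight of the monomial obtained by matching the elements of `J` with the exponents given
by `a` in increasing order, where the `j`-th variable has weight `j + 1`. -/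
def matchWeight (J : Finset (Fin m)) (a : Fin k → ℕ) : ℕ :=
  ∑ x ∈ Finset.range (m + 1) ×ˢ Finset.range k, min (countGE J x.1) (levelGE a x.2)

lemma sum_ite_le_eq (j : Fin m) (t : Fin k) :
    ∑ x ∈ Finset.range (m + 1) ×ˢ Finset.range k,
      (if x.1 ≤ j.val then 1 else 0) * (if x.2 ≤ t.val then 1 else 0) =
      (j.val + 1) * (t.val + 1) := by
  have aux : ∀ {n c : ℕ}, c < n → ∑ x ∈ Finset.range n, (if x ≤ c then 1 else 0) = c + 1 := by
    intro n c h
    rw [← Finset.sum_filter, Finset.sum_const, smul_eq_mul, mul_one]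
    have : (Finset.range n).filter (· ≤ c) = Finset.range (c + 1) := by
      ext x
      simp only [Finset.mem_filter, Finset.mem_range]
      omega
    rw [this, Finset.card_range]
  rw [Finset.sum_product]
  refine (Finset.sum_mul_sum (Finset.range (m + 1)) (Finset.range k)
    (fun x => if x ≤ j.val then 1 else 0) (fun x => if x ≤ t.val then 1 else 0)).symm.trans ?_
  rw [aux (by omega), aux t.2]

lemma min_erase_sub_le {J : Finset (Fin m)} {a : Fin k → ℕ} {j : Fin m} {t : Fin k}
    (hj : j ∈ J) (ht : a t ≠ 0) (c s : ℕ) :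
    min (countGE (J.erase j) c) (levelGE (a - Pi.single t 1) s) +
      (if c ≤ j.val then 1 else 0) * (if s ≤ t.val then 1 else 0) ≤
    min (countGE J c) (levelGE a s) := by
  have h1 := countGE_erase hj c
  have h2 := levelGE_sub ht s
  split_ifs at * <;> omega

lemma matchWeight_erase_le {J : Finset (Fin m)} {a : Fin k → ℕ} {j : Fin m} {t : Fin k}
    (hj : j ∈ J) (ht : a t ≠ 0) :
    matchWeight (J.erase j) (a - Pi.single t 1) + (j.val + 1) * (t.val + 1) ≤
      matchWeight J a := by
  rw [← sum_ite_le_eq, matchWeight, ← Finset.sum_add_distrib]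
  exact Finset.sum_le_sum fun x _ => min_erase_sub_le hj ht x.1 x.2

lemma matchWeight_erase_lt {J : Finset (Fin m)} {a : Fin k → ℕ} {j : Fin m} {t : Fin k}
    (hJ : J.card = k + ∑ s, a s) (hj : j ∈ J) (ht : a t ≠ 0) (hlt : rankBelow J j < t) :
    matchWeight (J.erase j) (a - Pi.single t 1) + (j.val + 1) * (t.val + 1) <
      matchWeight J a := by
  rw [← sum_ite_le_eq, matchWeight, ← Finset.sum_add_distrib]
  refine Finset.sum_lt_sum (fun x _ => min_erase_sub_le hj ht x.1 x.2)
    ⟨(j.val + 1, rankBelow J j + 1), ?_, ?_⟩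
  · simp only [Finset.mem_product, Finset.mem_range]
    omega
  · have h1 := countGE_erase hj (j.val + 1)
    have h2 := levelGE_sub ht (rankBelow J j + 1)
    have h3 := levelGE_add_le a (t := rankBelow J j + 1) (by omega)
    have h4 := countGE_succ_add_one hj
    have h5 := rankBelow_add_countGE J j
    rw [levelGE_zero] at h3
    dsimp only
    split_ifs at * <;> omega

lemma matchWeight_erase_eq {J : Finset (Fin m)} {a : Fin k → ℕ} {j : Fin m} {t : Fin k}
    (hJ : J.card = k + ∑ s, a s) (hj : j ∈ J) (ht : a t ≠ 0) (hmin : ∀ s < t, a s = 0)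
    (hr : rankBelow J j = t) :
    matchWeight (J.erase j) (a - Pi.single t 1) + (j.val + 1) * (t.val + 1) =
      matchWeight J a := by
  rw [← sum_ite_le_eq, matchWeight, ← Finset.sum_add_distrib]
  refine Finset.sum_congr rfl fun x _ => ?_
  have h1 := countGE_erase hj x.1
  have h2 := levelGE_sub ht x.2
  have h3 := levelGE_add_eq hmin
  have h4 := countGE_succ_add_one hj
  have h5 := rankBelow_add_countGE J j
  have h6 := levelGE_succ a t
  rw [levelGE_zero] at h3
  split_ifs at * with hc hs hs
  · omega
  · have h7 := countGE_antitone J hc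
    have h8 := levelGE_antitone a (show t.val + 1 ≤ x.2 by omega)
    omega
  · have h7 := countGE_antitone J (show j.val + 1 ≤ x.1 by omega)
    have h8 := levelGE_antitone a hs
    omega
  · omega

end Combinatorics

section Triangular

variable {K V₁ V₀ T₁ T₀ Γ : Type*} [Field K] [AddCommGroup V₁] [AddCommGroup V₀] [Module K V₁]
  [Module K V₀] [LinearOrder Γ] {e₁ : T₁ → V₁} {e₀ : Module.Basis T₀ K V₀} {d : V₁ →ₗ[K] V₀}
  {P : T₁ → T₀ → Prop} {key : T₀ → Γ}

/-- `d` is triangular with respect to the matching `P`: if `τ` is matched with `σ`, then `σ` is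
the leading term of the image of `τ`. -/
def IsTriangular (e₁ : T₁ → V₁) (e₀ : Module.Basis T₀ K V₀) (d : V₁ →ₗ[K] V₀)
    (P : T₁ → T₀ → Prop) (key : T₀ → Γ) : Prop :=
  ∀ τ σ, P τ σ → ∃ u : K, u ≠ 0 ∧
    d (e₁ τ) - u • e₀ σ ∈ Submodule.span K (e₀ '' {ρ | key ρ < key σ})

lemma IsTriangular.exists_add [WellFoundedLT Γ] (h : IsTriangular e₁ e₀ d P key) (v : V₀) :
    ∃ w, ∃ u ∈ Submodule.span K (e₀ '' {σ | ¬ ∃ τ, P τ σ}), d w + u = v := by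
  set S := LinearMap.range d ⊔ Submodule.span K (e₀ '' {σ | ¬ ∃ τ, P τ σ}) with hS
  suffices hv : v ∈ S by
    obtain ⟨_, ⟨w, rfl⟩, u, hu, e⟩ := Submodule.mem_sup.mp hv
    exact ⟨w, u, hu, e⟩
  have key' : ∀ g σ, key σ = g → e₀ σ ∈ S := by
    intro g
    induction g using WellFoundedLT.induction with
    | _ g ih =>
      rintro σ rfl
      by_cases hσ : ∃ τ, P τ σ
      · obtain ⟨τ, hτ⟩ := hσ
        obtain ⟨u, hu, hmem⟩ := h τ σ hτ
        have hle : Submodule.span K (e₀ '' {ρ | key ρ < key σ}) ≤ S := by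
          rw [Submodule.span_le]
          rintro _ ⟨ρ, hρ, rfl⟩
          exact ih _ hρ ρ rfl
        have h1 : d (e₁ τ) ∈ S := Submodule.mem_sup_left ⟨_, rfl⟩
        have h2 := sub_mem h1 (hle hmem)
        rw [sub_sub_cancel] at h2
        exact (Submodule.smul_mem_iff S hu).mp h2
      · exact Submodule.mem_sup_right (Submodule.subset_span ⟨σ, hσ, rfl⟩)
  have : (⊤ : Submodule K V₀) ≤ S := by
    rw [← e₀.span_eq, Submodule.span_le]
    rintro _ ⟨σ, rfl⟩
    exact key' _ σ rfl
  exact this trivial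

lemma IsTriangular.eq_zero (h : IsTriangular e₁ e₀ d P key)
    (hinj : ∀ τ τ' σ, P τ σ → P τ' σ → τ = τ') {v : V₁}
    (hv : v ∈ Submodule.span K (e₁ '' {τ | ∃ σ, P τ σ})) (hd : d v = 0) : v = 0 := by
  classical
  obtain ⟨f, hf, rfl⟩ := (Finsupp.mem_span_image_iff_linearCombination K).mp hv
  by_contra hne
  have hf0 : f.support.Nonempty := by
    rw [Finsupp.support_nonempty_iff]
    rintro rfl
    simp at hne
  have hex : ∀ τ : f.support, ∃ σ, P τ σ := fun τ => hf τ.2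
  choose s hs using hex
  obtain ⟨τ, -, hmax⟩ := f.support.attach.exists_max_image (fun τ => key (s τ))
    (by simpa using hf0)
  rw [Finsupp.linearCombination_apply, map_finsuppSum, Finsupp.sum] at hd
  have h1 := congrArg (fun x => e₀.repr x (s τ)) hd
  simp only [map_sum, Finsupp.finsetSum_apply, map_smul, Finsupp.smul_apply, map_zero,
    Finsupp.zero_apply, smul_eq_mul] at h1
  have coeff_eq : ∀ τ' : f.support, ∃ u : K, u ≠ 0 ∧
      e₀.repr (d (e₁ τ')) (s τ) = if τ' = τ then u else 0 := by
    intro τ'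
    obtain ⟨u, hu, hmem⟩ := h τ' (s τ') (hs τ')
    refine ⟨u, hu, ?_⟩
    rw [e₀.mem_span_image] at hmem
    have h2 : e₀.repr (d (e₁ τ') - u • e₀ (s τ')) (s τ) = 0 := by
      by_contra hc
      exact absurd (hmem (Finsupp.mem_support_iff.mpr hc)) (not_lt.mpr (hmax τ' (by simp)))
    rw [map_sub, map_smul, e₀.repr_self, Finsupp.sub_apply, Finsupp.smul_apply,
      Finsupp.single_apply, sub_eq_zero] at h2
    rw [h2]
    by_cases h3 : τ' = τ
    · simp [h3]
    · have : s τ' ≠ s τ := fun e => h3 (Subtype.ext (hinj _ _ _ (hs τ') (e ▸ hs τ)))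
      simp [h3, this]
  rw [Finset.sum_eq_single τ.1] at h1
  · obtain ⟨u, hu, e⟩ := coeff_eq τ
    rw [e, if_pos rfl] at h1
    exact (mul_ne_zero (Finsupp.mem_support_iff.mp τ.2) hu) h1
  · intro τ' hτ' hne'
    obtain ⟨u, hu, e⟩ := coeff_eq ⟨τ', hτ'⟩
    rw [e, if_neg (fun hh => hne' (congrArg Subtype.val hh)), mul_zero]
  · exact fun hτ => absurd τ.2 hτ

end Triangular

section Complex

variable {m k : ℕ} {K : Type*} [Field K]

/-- The entry in row `t` and column `j` of the matrix obtained from the Vandermonde matrix by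
subtracting the column `0` from all others and removing the row of ones and the column `0`. -/
noncomputable def reducedEntry (K : Type*) [Field K] (t : Fin k) (j : Fin m) :
    MvPolynomial (Fin (m + 1)) K :=
  X j.succ ^ (t.val + 1) - X 0 ^ (t.val + 1)

/-- The pairs `(j, t)` for which the cell `p` has a face. -/
def faces (p : Finset (Fin m) × (Fin k → ℕ)) : Finset (Fin m × Fin k) :=
  p.1 ×ˢ Finset.univ.filter fun t => p.2 t ≠ 0

lemma mem_faces {p : Finset (Fin m) × (Fin k → ℕ)} {x : Fin m × Fin k} :
    x ∈ faces p ↔ x.1 ∈ p.1 ∧ p.2 x.2 ≠ 0 := by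
  simp [faces]

/-- The face of the cell `p` obtained by removing `x`. -/
def face (p : Finset (Fin m) × (Fin k → ℕ)) (x : Fin m × Fin k) :
    Finset (Fin m) × (Fin k → ℕ) :=
  (p.1.erase x.1, p.2 - Pi.single x.2 1)

/-- The incidence coefficient of a face. -/
noncomputable def incidence (K : Type*) [Field K] (p : Finset (Fin m) × (Fin k → ℕ))
    (x : Fin m × Fin k) : MvPolynomial (Fin (m + 1)) K :=
  (-1) ^ rankBelow p.1 x.1 * reducedEntry K x.2 x.1

/-- The differential `Λ F ⊗ D G* → Λ F ⊗ D G*` of the Eagon–Northcott complex. -/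
noncomputable def koszulMap (K : Type*) [Field K] (m k : ℕ) :
    ((Finset (Fin m) × (Fin k → ℕ)) →₀ MvPolynomial (Fin (m + 1)) K)
      →ₗ[MvPolynomial (Fin (m + 1)) K]
    ((Finset (Fin m) × (Fin k → ℕ)) →₀ MvPolynomial (Fin (m + 1)) K) :=
  Finsupp.linearCombination _ fun p =>
    ∑ x ∈ faces p, incidence K p x • Finsupp.single (face p x) 1

lemma koszulMap_single (p : Finset (Fin m) × (Fin k → ℕ)) (r : MvPolynomial (Fin (m + 1)) K) :
    koszulMap K m k (Finsupp.single p r) =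
      r • ∑ x ∈ faces p, incidence K p x • Finsupp.single (face p x) 1 := by
  rw [koszulMap, Finsupp.linearCombination_single]

lemma face_face (p : Finset (Fin m) × (Fin k → ℕ)) (x y : Fin m × Fin k) :
    face (face p x) y = face (face p y) x := by
  simp only [face, Prod.mk.injEq]
  exact ⟨Finset.erase_right_comm, tsub_right_comm⟩

lemma neg_one_pow_rankBelow_erase (R : Type*) [CommRing R] {J : Finset (Fin m)} {i j : Fin m}
    (hi : i ∈ J) (hj : j ∈ J) (hij : i ≠ j) :
    (-1 : R) ^ rankBelow J i * (-1) ^ rankBelow (J.erase i) j +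
      (-1) ^ rankBelow J j * (-1) ^ rankBelow (J.erase j) i = 0 := by
  wlog h : i < j generalizing i j
  · rw [add_comm]
    exact this hj hi hij.symm (lt_of_le_of_ne (not_lt.mp h) hij.symm)
  rw [rankBelow_erase_of_le J h.le, ← rankBelow_erase_add_one hi h]
  ring

lemma mem_faces_face {p : Finset (Fin m) × (Fin k → ℕ)} {x y : Fin m × Fin k}
    (hx : x ∈ faces p) (hy : y ∈ faces (face p x)) :
    y ∈ faces p ∧ x ∈ faces (face p y) ∧ x.1 ≠ y.1 := by
  simp only [mem_faces, face, Finset.mem_erase, Pi.sub_apply] at *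
  obtain ⟨⟨hne, h1⟩, h2⟩ := hy
  refine ⟨⟨h1, by omega⟩, ⟨⟨hne.symm, hx.1⟩, ?_⟩, hne.symm⟩
  by_cases h : x.2 = y.2
  · rw [← h] at h2 ⊢
    exact h2
  · rw [Pi.single_apply, if_neg h]
    exact hx.2

lemma koszulMap_comp_self : koszulMap K m k ∘ₗ koszulMap K m k = 0 := by
  ext1 p
  ext1
  simp only [LinearMap.comp_apply, Finsupp.lsingle_apply, koszulMap_single, map_sum,
    map_smul, LinearMap.zero_apply, Finset.smul_sum, smul_smul]
  rw [Finset.sum_sigma']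
  refine Finset.sum_involution (fun z _ => ⟨z.2, z.1⟩) ?_ ?_ ?_ ?_
  · rintro ⟨x, y⟩ hz
    obtain ⟨hx, hy⟩ := Finset.mem_sigma.mp hz
    obtain ⟨hy', hx', hne⟩ := mem_faces_face hx hy
    dsimp only
    rw [face_face p y x, ← add_smul]
    refine (congrArg (· • _) ?_).trans (zero_smul _ _)
    have := neg_one_pow_rankBelow_erase (MvPolynomial (Fin (m + 1)) K)
      (mem_faces.mp hx).1 (mem_faces.mp hy').1 hne
    simp only [incidence, face]
    dsimp only at this
    linear_combination (reducedEntry K x.2 x.1 * reducedEntry K y.2 y.1) * this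
  · rintro ⟨x, y⟩ hz - h
    obtain ⟨hx, hy⟩ := Finset.mem_sigma.mp hz
    obtain ⟨hy', hx', hne⟩ := mem_faces_face hx hy
    simp only [Sigma.mk.injEq] at h
    exact hne (by rw [h.1])
  · rintro ⟨x, y⟩ hz
    obtain ⟨hx, hy⟩ := Finset.mem_sigma.mp hz
    obtain ⟨hy', hx', hne⟩ := mem_faces_face hx hy
    exact Finset.mem_sigma.mpr ⟨hy', hx'⟩
  · intros
    rfl

/-- The generators of the Eagon–Northcott complex in homological degree `i + 1`. -/
def cells (m k i : ℕ) : Set (Finset (Fin m) × (Fin k → ℕ)) :=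
  {p | p.1.card = k + i ∧ ∑ s, p.2 s = i}

lemma face_mem_cells {i : ℕ} {p : Finset (Fin m) × (Fin k → ℕ)} (hp : p ∈ cells m k (i + 1))
    {x : Fin m × Fin k} (hx : x ∈ faces p) : face p x ∈ cells m k i := by
  obtain ⟨h1, h2⟩ := hp
  obtain ⟨h3, h4⟩ := mem_faces.mp hx
  refine ⟨by simp [face, Finset.card_erase_of_mem h3, h1], ?_⟩
  have h5 := levelGE_sub h4 0
  rw [levelGE_zero, levelGE_zero, if_pos (Nat.zero_le _)] at h5
  simp only [face]
  omega

/-- The differentials of the Eagon–Northcott complex in positive degrees. -/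
noncomputable def enMap (K : Type*) [Field K] (m k i : ℕ) :
    (cells m k (i + 1) →₀ MvPolynomial (Fin (m + 1)) K) →ₗ[MvPolynomial (Fin (m + 1)) K]
      (cells m k i →₀ MvPolynomial (Fin (m + 1)) K) :=
  Finsupp.lsubtypeDomain (cells m k i) ∘ₗ koszulMap K m k ∘ₗ
    Finsupp.lmapDomain _ _ Subtype.val

lemma lsubtypeDomain_single {i : ℕ} {p : Finset (Fin m) × (Fin k → ℕ)} (hp : p ∈ cells m k i)
    (r : MvPolynomial (Fin (m + 1)) K) :
    Finsupp.lsubtypeDomain (R := MvPolynomial (Fin (m + 1)) K) (cells m k i)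
      (Finsupp.single p r) = Finsupp.single ⟨p, hp⟩ r := by
  classical
  ext1 q
  simp [Finsupp.lsubtypeDomain_apply, Finsupp.single_apply, Subtype.ext_iff]

lemma enMap_single {i : ℕ} (p : cells m k (i + 1)) (r : MvPolynomial (Fin (m + 1)) K) :
    enMap K m k i (Finsupp.single p r) =
      ∑ x ∈ (faces p.1).attach, (r * incidence K p.1 x.1) •
        Finsupp.single ⟨face p.1 x.1, face_mem_cells p.2 x.2⟩ 1 := by
  simp only [enMap, LinearMap.comp_apply, Finsupp.lmapDomain_apply, Finsupp.mapDomain_single,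
    koszulMap_single, map_smul, map_sum]
  rw [← Finset.sum_attach, Finset.smul_sum]
  refine Finset.sum_congr rfl fun x _ => ?_
  rw [smul_smul, lsubtypeDomain_single (face_mem_cells p.2 x.2)]

lemma mapDomain_enMap {i : ℕ} (z : cells m k (i + 1) →₀ MvPolynomial (Fin (m + 1)) K) :
    Finsupp.mapDomain Subtype.val (enMap K m k i z) =
      koszulMap K m k (Finsupp.mapDomain Subtype.val z) := by
  have : Finsupp.lmapDomain _ _ Subtype.val ∘ₗ enMap K m k i =
      koszulMap K m k ∘ₗ
        Finsupp.lmapDomain _ (MvPolynomial (Fin (m + 1)) K) Subtype.val := by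
    ext1 p
    ext1
    simp only [LinearMap.comp_apply, Finsupp.lsingle_apply, enMap_single, one_mul, map_sum,
      map_smul, Finsupp.lmapDomain_apply, Finsupp.mapDomain_single, koszulMap_single, one_smul]
    exact Finset.sum_attach (faces p.1)
      (fun x => incidence K p.1 x • Finsupp.single (face p.1 x) 1)
  exact LinearMap.congr_fun this z

lemma enMap_enMap {i : ℕ} (z : cells m k (i + 1 + 1) →₀ MvPolynomial (Fin (m + 1)) K) :
    enMap K m k i (enMap K m k (i + 1) z) = 0 := by
  have h : koszulMap K m k (koszulMap K m k (Finsupp.mapDomain Subtype.val z)) = 0 :=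
    LinearMap.congr_fun koszulMap_comp_self _
  rw [← mapDomain_enMap, ← mapDomain_enMap] at h
  exact Finsupp.mapDomain_injective Subtype.val_injective (by simpa using h)

end Complex

section Matching

variable {m k : ℕ}

/-- The weight of a monomial, the variable `c` having weight `c`. -/
def varWeight (α : Fin (m + 1) →₀ ℕ) : ℕ := ∑ c, c.val * α c

lemma varWeight_add (α γ : Fin (m + 1) →₀ ℕ) :
    varWeight (α + γ) = varWeight α + varWeight γ := by
  simp [varWeight, mul_add, Finset.sum_add_distrib]

lemma varWeight_single (c : Fin (m + 1)) (e : ℕ) :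
    varWeight (Finsupp.single c e) = c.val * e := by
  rw [varWeight, Finset.sum_eq_single c (fun x _ hx => by simp [hx.symm]) (by simp)]
  simp

/-- The key by which the terms of the Eagon–Northcott complex are compared. -/
def cellKey (q : Finset (Fin m) × (Fin k → ℕ)) (γ : Fin (m + 1) →₀ ℕ) : ℕ ×ₗ ℕ :=
  toLex (varWeight γ + matchWeight q.1 q.2, ∑ j ∈ q.1, j.val)

/-- The term with cell `p` and exponent `α` is matched with the term with cell `q` and exponent `γ`
along the face `x` of `p`. -/
structure MatchedAt (p : Finset (Fin m) × (Fin k → ℕ)) (α : Fin (m + 1) →₀ ℕ)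
    (q : Finset (Fin m) × (Fin k → ℕ)) (γ : Fin (m + 1) →₀ ℕ) (x : Fin m × Fin k) : Prop where
  mem : x.1 ∈ p.1
  ne_zero : p.2 x.2 ≠ 0
  eq_zero : ∀ s < x.2, p.2 s = 0
  rank : rankBelow p.1 x.1 = x.2
  greedy : ∀ c < x.1, c ∉ p.1 → α c.succ ≤ rankBelow p.1 c
  face_eq : q = face p x
  exponent_eq : γ = α + Finsupp.single x.1.succ (x.2.val + 1)

variable {p p' q : Finset (Fin m) × (Fin k → ℕ)} {α α' γ : Fin (m + 1) →₀ ℕ}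
  {x x' : Fin m × Fin k}

lemma MatchedAt.mem_faces (h : MatchedAt p α q γ x) : x ∈ faces p :=
  _root_.mem_faces.mpr ⟨h.mem, h.ne_zero⟩

lemma MatchedAt.notMem (h : MatchedAt p α q γ x) : x.1 ∉ q.1 := by
  rw [h.face_eq]
  simp [face]

lemma MatchedAt.not_lt (h : MatchedAt p α q γ x) (h' : MatchedAt p' α' q γ x') :
    ¬ x.1 < x'.1 := by
  intro hlt
  have h1 : x.1 ∉ p'.1 := by
    have := h.notMem
    rw [h'.face_eq] at this
    simpa [face, hlt.ne] using this
  have h2 := h'.greedy _ hlt h1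
  have h3 : γ x.1.succ = α' x.1.succ := by
    rw [h'.exponent_eq]
    simp [hlt.ne']
  have h4 : x.2.val + 1 ≤ γ x.1.succ := by
    rw [h.exponent_eq]
    simp
  have h5 : rankBelow p'.1 x.1 = rankBelow p.1 x.1 := by
    rw [← rankBelow_erase_of_le p.1 le_rfl, ← rankBelow_erase_of_le p'.1 hlt.le]
    have e1 := congrArg Prod.fst h.face_eq
    have e2 := congrArg Prod.fst h'.face_eq
    simp only [face] at e1 e2
    rw [← e1, ← e2]
  have := h.rank
  omega

lemma MatchedAt.unique (h : MatchedAt p α q γ x) (h' : MatchedAt p' α' q γ x') :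
    p = p' ∧ α = α' := by
  have hj : x.1 = x'.1 :=
    le_antisymm (_root_.not_lt.mp (h'.not_lt h)) (_root_.not_lt.mp (h.not_lt h'))
  have e1 := h.face_eq.symm.trans h'.face_eq
  simp only [face, Prod.mk.injEq] at e1
  have hJ : p.1 = p'.1 := by
    rw [← Finset.insert_erase h.mem, ← Finset.insert_erase h'.mem, e1.1, hj]
  have ht : x.2 = x'.2 := Fin.ext (by rw [← h.rank, ← h'.rank, hJ, hj])
  refine ⟨Prod.ext hJ ?_, ?_⟩
  · funext s
    have e2 := congrFun e1.2 s
    have := h.ne_zero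
    have := h'.ne_zero
    rw [← ht] at e2 this
    by_cases hs : s = x.2
    · subst hs
      simp at e2
      omega
    · simpa [hs] using e2
  · have e3 := h.exponent_eq.symm.trans h'.exponent_eq
    rw [hj, ht] at e3
    exact add_right_cancel e3

lemma mem_cells_of_face {i : ℕ} (hx : x ∈ faces p) (h : face p x ∈ cells m k i) :
    p ∈ cells m k (i + 1) := by
  obtain ⟨h1, h2⟩ := h
  obtain ⟨h3, h4⟩ := mem_faces.mp hx
  simp only [face] at h1 h2
  have h5 := levelGE_sub h4 0
  rw [levelGE_zero, levelGE_zero, if_pos (Nat.zero_le _)] at h5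
  refine ⟨?_, by omega⟩
  rw [← Finset.card_erase_add_one h3, h1]
  ring

lemma exists_matchedAt_above (c : Fin m) (hc : c ∉ q.1) (hk : rankBelow q.1 c < k)
    (hlow : ∀ s : Fin k, s.val < rankBelow q.1 c → q.2 s = 0)
    (hγ : rankBelow q.1 c < γ c.succ) : ∃ p α x, MatchedAt p α q γ x := by
  classical
  set S := Finset.univ.filter fun c => c ∉ q.1 ∧ rankBelow q.1 c < γ c.succ with hS
  have hcS : c ∈ S := by simp [hS, hc, hγ]
  set c₀ := S.min' ⟨c, hcS⟩ with hc₀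
  have hle : c₀ ≤ c := S.min'_le _ hcS
  have hmem : c₀ ∈ S := S.min'_mem _
  obtain ⟨hn, hlt⟩ := (Finset.mem_filter.mp hmem).2
  have hmin : ∀ d < c₀, d ∉ q.1 → γ d.succ ≤ rankBelow q.1 d := by
    intro d hd hdq
    by_contra hcon
    exact absurd (S.min'_le d (by
      simp only [hS, Finset.mem_filter, Finset.mem_univ, true_and]
      exact ⟨hdq, not_le.mp hcon⟩)) (not_le.mpr hd)
  have hr := rankBelow_mono q.1 hle
  have hins : ∀ d ≤ c₀, rankBelow (insert c₀ q.1) d = rankBelow q.1 d := fun d hd =>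
    rankBelow_congr fun e he => by simp [(he.trans_le hd).ne]
  refine ⟨(insert c₀ q.1, q.2 + Pi.single ⟨rankBelow q.1 c₀, by omega⟩ 1),
    γ - Finsupp.single c₀.succ (rankBelow q.1 c₀ + 1), (c₀, ⟨rankBelow q.1 c₀, by omega⟩),
    ?_, ?_, ?_, ?_, ?_, ?_, ?_⟩
  · simp
  · simp
  · intro s hs
    have : s ≠ ⟨rankBelow q.1 c₀, by omega⟩ := hs.ne
    have h1 : s.val < rankBelow q.1 c₀ := hs
    simp [this, hlow s (by omega)]
  · exact hins _ le_rfl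
  · intro d hd hdp
    rw [Finset.mem_insert, not_or] at hdp
    dsimp only
    rw [hins d hd.le]
    refine le_trans ?_ (hmin d hd hdp.2)
    simp
  · refine Prod.ext ?_ ?_
    · simp [face, hn]
    · simp [face]
  · ext d
    by_cases h : d = c₀.succ
    · subst h
      simp
      omega
    · simp [Ne.symm h]

lemma exists_matchedAt_below {i : ℕ} (hq : q ∈ cells m k (i + 1))
    (h : ¬ ∃ p α x, MatchedAt p α q γ x) : ∃ p α x, MatchedAt q γ p α x := by
  classical
  have hne : ∃ s, q.2 s ≠ 0 := by
    by_contra hcon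
    push Not at hcon
    have := hq.2
    simp [hcon] at this
  set s := Fin.find _ hne with hs
  have hs0 : q.2 s ≠ 0 := Fin.find_spec hne
  have hmin : ∀ t < s, q.2 t = 0 := fun t ht => not_not.mp (Fin.find_min hne ht)
  obtain ⟨j, hj, hjs⟩ := exists_rankBelow_eq (J := q.1) (s := s.val) (by
    have := s.2
    rw [hq.1]
    omega)
  refine ⟨_, _, (j, s), hj, hs0, hmin, hjs, ?_, rfl, rfl⟩
  intro c hc hcq
  by_contra hcon
  have hle := rankBelow_mono q.1 (show c ≤ j from le_of_lt hc)
  refine h (exists_matchedAt_above c hcq (by have := s.2; omega) (fun t ht => hmin t ?_)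
    (not_le.mp hcon))
  exact Fin.lt_def.mpr (by omega)

lemma not_exists_matchedAt_zero {γ : Fin (m + 1) →₀ ℕ} (hq : q ∈ cells m k 0)
    (h : ¬ ∃ p α x, MatchedAt p α q γ x) (c : Fin m) (hc : c ∉ q.1)
    (hk : rankBelow q.1 c < k) : γ c.succ ≤ rankBelow q.1 c := by
  by_contra hcon
  refine h (exists_matchedAt_above c hc hk (fun s _ => ?_) (not_le.mp hcon))
  exact (Finset.sum_eq_zero_iff.mp hq.2) s (Finset.mem_univ _)

lemma MatchedAt.key_eq {i : ℕ} (hp : p ∈ cells m k (i + 1)) (h : MatchedAt p α q γ x) :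
    cellKey q γ = toLex (varWeight α + matchWeight p.1 p.2, ∑ j ∈ p.1.erase x.1, j.val) := by
  have h1 := matchWeight_erase_eq (hp.1.trans (by rw [hp.2])) h.mem h.ne_zero h.eq_zero h.rank
  rw [h.face_eq, h.exponent_eq]
  simp only [cellKey, face, varWeight_add, varWeight_single, Fin.val_succ]
  rw [← h1]
  congr 2
  ring

lemma MatchedAt.key_lt {i : ℕ} (hp : p ∈ cells m k (i + 1)) (h : MatchedAt p α q γ x)
    (hx' : x' ∈ faces p) (hne : x' ≠ x) :
    cellKey (face p x') (α + Finsupp.single x'.1.succ (x'.2.val + 1)) < cellKey q γ := by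
  rw [h.key_eq hp]
  obtain ⟨h1, h2⟩ := _root_.mem_faces.mp hx'
  simp only [cellKey, face, varWeight_add, varWeight_single, Fin.val_succ]
  rw [Prod.Lex.toLex_lt_toLex]
  have hJ : p.1.card = k + ∑ s, p.2 s := hp.1.trans (by rw [hp.2])
  have hle := matchWeight_erase_le h1 h2
  have hlt := matchWeight_erase_lt hJ h1 h2
  have hmin : x.2 ≤ x'.2 := _root_.not_lt.mp fun hc => h2 (h.eq_zero _ hc)
  have hr := h.rank
  rw [Fin.le_def] at hmin
  dsimp only
  rcases lt_trichotomy x'.1 x.1 with hj | hj | hj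
  · left
    have := rankBelow_lt h1 hj
    have := hlt (by omega)
    omega
  · left
    have h3 : x'.2 ≠ x.2 := fun e => hne (Prod.ext hj e)
    rw [Fin.ext_iff.ne] at h3
    have := hlt (by rw [hj]; omega)
    omega
  · have h3 : ∑ j ∈ p.1.erase x'.1, j.val < ∑ j ∈ p.1.erase x.1, j.val := by
      have e1 := Finset.sum_erase_add p.1 (fun j => j.val) h.mem
      have e2 := Finset.sum_erase_add p.1 (fun j => j.val) h1
      rw [Fin.lt_def] at hj
      omega
    rcases hle.lt_or_eq with h4 | h4
    · left
      omega
    · right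
      exact ⟨by omega, h3⟩

lemma MatchedAt.key_zero_lt {i : ℕ} (hp : p ∈ cells m k (i + 1)) (h : MatchedAt p α q γ x)
    (hx' : x' ∈ faces p) :
    cellKey (face p x') (α + Finsupp.single 0 (x'.2.val + 1)) < cellKey q γ := by
  rw [h.key_eq hp]
  obtain ⟨h1, h2⟩ := _root_.mem_faces.mp hx'
  simp only [cellKey, face, varWeight_add, varWeight_single, Fin.val_zero, zero_mul, add_zero]
  rw [Prod.Lex.toLex_lt_toLex]
  have hle := matchWeight_erase_le h1 h2
  have : 0 < (x'.1.val + 1) * (x'.2.val + 1) := by positivity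
  left
  dsimp only
  omega

end Matching

section Exactness

variable {m k : ℕ} {K : Type*} [Field K]

lemma monomial_mul_incidence (p : Finset (Fin m) × (Fin k → ℕ)) (α : Fin (m + 1) →₀ ℕ)
    (x : Fin m × Fin k) :
    monomial α (1 : K) * incidence K p x = (-1 : K) ^ rankBelow p.1 x.1 •
      (monomial (α + Finsupp.single x.1.succ (x.2.val + 1)) 1 -
        monomial (α + Finsupp.single 0 (x.2.val + 1)) 1) := by
  have hC : C ((-1 : K) ^ rankBelow p.1 x.1) =
      (-1 : MvPolynomial (Fin (m + 1)) K) ^ rankBelow p.1 x.1 := by simp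
  rw [incidence, reducedEntry, X_pow_eq_monomial, X_pow_eq_monomial, smul_eq_C_mul, hC,
    mul_left_comm, mul_sub (monomial α (1 : K)), monomial_mul, monomial_mul, mul_one]

lemma enMap_termBasis {i : ℕ} (p : cells m k (i + 1)) (α : Fin (m + 1) →₀ ℕ) :
    enMap K m k i (termBasis (Fin (m + 1)) K (cells m k (i + 1)) ⟨p, α⟩) =
      ∑ x ∈ (faces p.1).attach, (-1 : K) ^ rankBelow p.1.1 x.1.1 •
        (termBasis (Fin (m + 1)) K (cells m k i) ⟨⟨face p.1 x.1, face_mem_cells p.2 x.2⟩,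
            α + Finsupp.single x.1.1.succ (x.1.2.val + 1)⟩ -
          termBasis (Fin (m + 1)) K (cells m k i) ⟨⟨face p.1 x.1, face_mem_cells p.2 x.2⟩,
            α + Finsupp.single 0 (x.1.2.val + 1)⟩) := by
  rw [termBasis_apply, enMap_single]
  refine Finset.sum_congr rfl fun x _ => ?_
  rw [monomial_mul_incidence, termBasis_apply, termBasis_apply, ← Finsupp.single_sub,
    Finsupp.smul_single, Finsupp.smul_single, smul_eq_mul, mul_one]

/-- The matching on the terms of the Eagon–Northcott complex. -/
def TermMatch {i : ℕ} (τ : Σ _ : cells m k (i + 1), Fin (m + 1) →₀ ℕ)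
    (σ : Σ _ : cells m k i, Fin (m + 1) →₀ ℕ) : Prop :=
  ∃ x, MatchedAt τ.1.1 τ.2 σ.1.1 σ.2 x

lemma TermMatch.unique {i : ℕ} {τ τ' : Σ _ : cells m k (i + 1), Fin (m + 1) →₀ ℕ}
    {σ : Σ _ : cells m k i, Fin (m + 1) →₀ ℕ} (h : TermMatch τ σ) (h' : TermMatch τ' σ) :
    τ = τ' := by
  obtain ⟨x, hx⟩ := h
  obtain ⟨x', hx'⟩ := h'
  obtain ⟨p, α⟩ := τ
  obtain ⟨p', α'⟩ := τ'
  obtain ⟨e1, e2⟩ := hx.unique hx'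
  obtain rfl := Subtype.ext e1
  obtain rfl := e2
  rfl

lemma exists_matchedAt_iff_exists_termMatch {i : ℕ}
    (σ : Σ _ : cells m k i, Fin (m + 1) →₀ ℕ) :
    (∃ p α x, MatchedAt p α σ.1.1 σ.2 x) ↔ ∃ τ, TermMatch τ σ := by
  constructor
  · rintro ⟨p, α, x, h⟩
    exact ⟨⟨⟨p, mem_cells_of_face h.mem_faces (h.face_eq ▸ σ.1.2)⟩, α⟩, x, h⟩
  · rintro ⟨τ, x, h⟩
    exact ⟨_, _, x, h⟩

lemma exists_termMatch_below {i : ℕ} (σ : Σ _ : cells m k (i + 1), Fin (m + 1) →₀ ℕ)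
    (h : ¬ ∃ τ, TermMatch τ σ) : ∃ ρ, TermMatch σ ρ := by
  rw [← exists_matchedAt_iff_exists_termMatch] at h
  obtain ⟨p, α, x, hx⟩ := exists_matchedAt_below σ.1.2 h
  exact ⟨⟨⟨p, hx.face_eq ▸ face_mem_cells σ.1.2 hx.mem_faces⟩, α⟩, x, hx⟩

lemma isTriangular_enMap (K : Type*) [Field K] (m k i : ℕ) :
    IsTriangular (termBasis (Fin (m + 1)) K (cells m k (i + 1)))
      (termBasis (Fin (m + 1)) K (cells m k i)) ((enMap K m k i).restrictScalars K)
      TermMatch (fun σ => cellKey σ.1.1 σ.2) := by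
  classical
  rintro ⟨p, α⟩ ⟨q, γ⟩ ⟨x, hx⟩
  refine ⟨(-1) ^ rankBelow p.1.1 x.1, pow_ne_zero _ (by simp), ?_⟩
  set S := Submodule.span K (termBasis (Fin (m + 1)) K (cells m k i) ''
    {ρ | cellKey ρ.1.1 ρ.2 < cellKey q.1 γ}) with hS
  rw [LinearMap.restrictScalars_apply, enMap_termBasis]
  simp only [smul_sub, Finset.sum_sub_distrib]
  rw [sub_right_comm]
  refine sub_mem ?_ (sum_mem fun x' _ => S.smul_mem _ (Submodule.subset_span
    ⟨_, hx.key_zero_lt p.2 x'.2, rfl⟩))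
  rw [← Finset.add_sum_erase _ _ (Finset.mem_attach _ ⟨x, hx.mem_faces⟩)]
  have hterm : (⟨⟨face p.1 x, face_mem_cells p.2 hx.mem_faces⟩,
      α + Finsupp.single x.1.succ (x.2.val + 1)⟩ :
        Σ _ : cells m k i, Fin (m + 1) →₀ ℕ) = ⟨q, γ⟩ := by
    have h1 : (⟨face p.1 x, face_mem_cells p.2 hx.mem_faces⟩ : cells m k i) = q :=
      Subtype.ext hx.face_eq.symm
    have h2 : γ = _ := hx.exponent_eq
    rw [h1, h2]
  rw [hterm, add_sub_cancel_left]
  refine sum_mem fun x' hx' => S.smul_mem _ (Submodule.subset_span ⟨_, ?_, rfl⟩)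
  exact hx.key_lt p.2 x'.2 fun e => (Finset.mem_erase.mp hx').1 (Subtype.ext e)

lemma ker_enMap (K : Type*) [Field K] (m k i : ℕ) :
    LinearMap.ker (enMap K m k i) = LinearMap.range (enMap K m k (i + 1)) := by
  ext z
  rw [LinearMap.mem_ker, LinearMap.mem_range]
  constructor
  · intro hz
    obtain ⟨w, u, hu, e⟩ := (isTriangular_enMap K m k (i + 1)).exists_add z
    have hu0 : u = 0 := by
      refine (isTriangular_enMap K m k i).eq_zero (fun τ τ' σ h h' => h.unique h')
        (Submodule.span_mono (Set.image_mono fun σ hσ => exists_termMatch_below σ hσ) hu) ?_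
      have h1 := congrArg (enMap K m k i) e
      rw [map_add, LinearMap.restrictScalars_apply, enMap_enMap, zero_add, hz] at h1
      exact h1
    rw [hu0, add_zero] at e
    exact ⟨w, e⟩
  · rintro ⟨w, rfl⟩
    exact enMap_enMap w

end Exactness

section Vandermonde

variable {m k : ℕ} {K : Type*} [Field K]

/-- The Vandermonde product of the variables in `S`. -/
noncomputable def vanProd (K : Type*) [Field K] {n : ℕ} (S : Finset (Fin n)) :
    MvPolynomial (Fin n) K :=
  ∏ b ∈ S, ∏ a ∈ S with a < b, (X b - X a)

lemma det_vandermonde_X_of_strictMono {n r : ℕ} {g : Fin r → Fin n} (hg : StrictMono g) :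
    (Matrix.vandermonde fun i => (X (g i) : MvPolynomial (Fin n) K)).det =
      vanProd K (Finset.univ.image g) := by
  rw [Matrix.det_vandermonde, vanProd, Finset.prod_image hg.injective.injOn,
    Finset.prod_sigma', Finset.prod_sigma']
  refine Finset.prod_bij' (i := fun x _ => ⟨x.2, g x.1⟩)
    (j := fun x _ => ⟨Function.extend g id (fun _ => x.1) x.2, x.1⟩) ?_ ?_ ?_ ?_ ?_
  · rintro ⟨a, b⟩ h
    simpa [hg.lt_iff_lt] using h
  · rintro ⟨b, _⟩ h
    obtain ⟨-, h⟩ := Finset.mem_sigma.mp h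
    obtain ⟨h1, h2⟩ := Finset.mem_filter.mp h
    obtain ⟨a, -, rfl⟩ := Finset.mem_image.mp h1
    simpa [hg.injective.extend_apply, hg.lt_iff_lt] using h2
  · rintro ⟨a, b⟩ h
    simp [hg.injective.extend_apply]
  · rintro ⟨b, _⟩ h
    obtain ⟨-, h⟩ := Finset.mem_sigma.mp h
    obtain ⟨h1, h2⟩ := Finset.mem_filter.mp h
    obtain ⟨a, -, rfl⟩ := Finset.mem_image.mp h1
    simp [hg.injective.extend_apply]
  · rintro ⟨a, b⟩ h
    rfl

lemma exists_sign_det_vandermonde_X {n r : ℕ} {g : Fin r → Fin n} (hg : Function.Injective g) :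
    ∃ u : ℤˣ, (Matrix.vandermonde fun i => (X (g i) : MvPolynomial (Fin n) K)).det =
      (u : ℤ) • vanProd K (Finset.univ.image g) := by
  refine ⟨Equiv.Perm.sign (Tuple.sort g), ?_⟩
  have h1 : StrictMono (g ∘ Tuple.sort g) :=
    (Tuple.monotone_sort g).strictMono_of_injective (hg.comp (Tuple.sort g).injective)
  have h2 := det_vandermonde_X_of_strictMono (K := K) h1
  have h3 := Matrix.det_permute (Tuple.sort g)
    (Matrix.vandermonde fun i => (X (g i) : MvPolynomial (Fin n) K))
  have h4 : Finset.univ.image (g ∘ Tuple.sort g) = Finset.univ.image g := by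
    ext x
    simp only [Finset.mem_image, Finset.mem_univ, true_and, Function.comp_apply]
    exact (Tuple.sort g).surjective.exists (p := fun y => g y = x) |>.symm
  rw [h4] at h2
  have h5 : (Matrix.vandermonde fun i => (X (g i) : MvPolynomial (Fin n) K)).submatrix
      (Tuple.sort g) id =
      Matrix.vandermonde fun i => (X ((g ∘ Tuple.sort g) i) : MvPolynomial (Fin n) K) := by
    ext1 i j
    simp [Matrix.vandermonde_apply]
  rw [h5, h2] at h3
  rw [h3, zsmul_eq_mul, ← mul_assoc, ← Int.cast_mul, ← Units.val_mul, Int.units_mul_self]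
  simp

lemma sum_pow_mul_det_vandermonde {R : Type*} [CommRing R] (v : Fin (k + 2) → R) {s : ℕ}
    (hs : s ≤ k) :
    ∑ c : Fin (k + 2), (-1) ^ (c : ℕ) * v c ^ s *
      (Matrix.vandermonde fun i => v (c.succAbove i)).det = 0 := by
  set A : Matrix (Fin (k + 2)) (Fin (k + 2)) R :=
    Matrix.of fun r c => Fin.cases (v c ^ s) (fun r' => v c ^ (r' : ℕ)) r with hA
  have hdet : A.det = 0 := by
    refine Matrix.det_zero_of_row_eq (i := 0) (j := Fin.succ ⟨s, by omega⟩)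
      (Fin.succ_ne_zero _).symm ?_
    funext c
    simp [hA]
  rw [Matrix.det_succ_row_zero] at hdet
  rw [← hdet]
  refine Finset.sum_congr rfl fun c _ => ?_
  rw [← Matrix.det_transpose]
  congr 2

lemma sum_det_vandermonde {R : Type*} [CommRing R] (v : Fin (k + 2) → R) (w : R) {s : ℕ}
    (hs : s ≤ k) :
    ∑ c : Fin (k + 2), (-1) ^ (c : ℕ) * (v c ^ s - w ^ s) *
      (Matrix.vandermonde fun i => v (c.succAbove i)).det = 0 := by
  have h1 := sum_pow_mul_det_vandermonde v hs
  have h2 := congrArg (w ^ s * ·) (sum_pow_mul_det_vandermonde v (Nat.zero_le k))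
  simp only [pow_zero, mul_one, mul_zero, Finset.mul_sum] at h2
  rw [← sub_eq_zero.mpr (h1.trans h2.symm), ← Finset.sum_sub_distrib]
  refine Finset.sum_congr rfl fun c _ => ?_
  ring

/-- The columns of the minor belonging to `J`. -/
def cone (J : Finset (Fin m)) : Finset (Fin (m + 1)) :=
  insert 0 (J.map (Fin.succEmb m))

lemma zero_mem_cone (J : Finset (Fin m)) : 0 ∈ cone J := by
  simp [cone]

lemma succ_mem_cone {J : Finset (Fin m)} {j : Fin m} : j.succ ∈ cone J ↔ j ∈ J := by
  simp [cone]

lemma cone_ext {J : Finset (Fin m)} {S : Finset (Fin (m + 1))} (h0 : 0 ∈ S)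
    (h : ∀ j, j.succ ∈ S ↔ j ∈ J) : S = cone J := by
  ext c
  cases c using Fin.cases with
  | zero => simp [h0, zero_mem_cone]
  | succ j => rw [h, succ_mem_cone]

lemma rankBelow_orderEmbOfFin {J : Finset (Fin m)} {r : ℕ} (hJ : J.card = r) (i : Fin r) :
    rankBelow J (J.orderEmbOfFin hJ i) = i := by
  have : J.filter (· < J.orderEmbOfFin hJ i) =
      (Finset.Iio i).map (J.orderEmbOfFin hJ).toEmbedding := by
    ext x
    simp only [Finset.mem_filter, Finset.mem_map, Finset.mem_Iio, RelEmbedding.coe_toEmbedding]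
    constructor
    · rintro ⟨h1, h2⟩
      rw [← Finset.mem_coe, ← Finset.range_orderEmbOfFin J hJ] at h1
      obtain ⟨a, rfl⟩ := h1
      exact ⟨a, by simpa using h2, rfl⟩
    · rintro ⟨a, ha, rfl⟩
      exact ⟨Finset.orderEmbOfFin_mem _ _ _, by simpa using ha⟩
  rw [rankBelow, this, Finset.card_map, Fin.card_Iio]

lemma strictMono_cons_succ {J : Finset (Fin m)} {r : ℕ} (hJ : J.card = r) :
    StrictMono (Fin.cons 0 (fun i => (J.orderEmbOfFin hJ i).succ) :
      Fin (r + 1) → Fin (m + 1)) := by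
  intro a b hab
  cases b using Fin.cases with
  | zero => exact absurd hab (Fin.not_lt_zero a)
  | succ b =>
    cases a using Fin.cases with
    | zero => simp
    | succ a => simpa using hab

lemma image_cons_succ {J : Finset (Fin m)} {r : ℕ} (hJ : J.card = r) :
    Finset.univ.image (Fin.cons 0 (fun i => (J.orderEmbOfFin hJ i).succ) :
      Fin (r + 1) → Fin (m + 1)) = cone J := by
  refine cone_ext (Finset.mem_image.mpr ⟨0, by simp⟩) fun j => ?_
  simp only [Finset.mem_image, Finset.mem_univ, true_and, Fin.exists_fin_succ, Fin.cons_zero,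
    Fin.cons_succ, Fin.succ_inj]
  rw [← Finset.mem_coe, ← Finset.range_orderEmbOfFin J hJ, Set.mem_range]
  simp [(Fin.succ_ne_zero j).symm]

lemma sum_incidence_mul_vanProd {J : Finset (Fin m)} (hJ : J.card = k + 1) (t : Fin k) :
    ∑ j ∈ J, (-1) ^ rankBelow J j * reducedEntry K t j * vanProd K (cone (J.erase j)) = 0 := by
  set f := J.orderEmbOfFin hJ with hf
  set g : Fin (k + 2) → Fin (m + 1) := Fin.cons 0 (fun i => (f i).succ) with hg
  have hmono : StrictMono g := strictMono_cons_succ hJ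
  have h := sum_det_vandermonde (fun c => (X (g c) : MvPolynomial (Fin (m + 1)) K)) (X 0)
    (s := t.val + 1) t.2
  rw [Fin.sum_univ_succ] at h
  simp only [hg, Fin.cons_zero, sub_self, mul_zero, zero_mul, zero_add, Fin.cons_succ,
    Fin.val_succ] at h
  have hJf : J = Finset.univ.map f.toEmbedding := by
    rw [Finset.map_eq_image, hf]
    simp
  have key : ∀ i : Fin (k + 1),
      (Matrix.vandermonde fun a => (X (g (i.succ.succAbove a)) :
        MvPolynomial (Fin (m + 1)) K)).det = vanProd K (cone (J.erase (f i))) := by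
    intro i
    rw [det_vandermonde_X_of_strictMono (g := fun a => g (i.succ.succAbove a))
      (hmono.comp (Fin.strictMono_succAbove _))]
    congr 1
    refine cone_ext (Finset.mem_image.mpr ⟨0, by simp [hg]⟩) fun j => ?_
    have h1 : j.succ ∈ Finset.univ.image g ↔ j ∈ J := by
      rw [image_cons_succ, succ_mem_cone]
    have h2 : j = f i ↔ j.succ = g i.succ := by simp [hg]
    rw [Finset.mem_erase, ← h1, ne_eq, h2]
    simp only [Finset.mem_image, Finset.mem_univ, true_and]
    constructor
    · rintro ⟨a, ha⟩
      rw [← ha]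
      exact ⟨fun e => Fin.succAbove_ne _ _ (hmono.injective e), _, rfl⟩
    · rintro ⟨h3, b, hb⟩
      obtain ⟨a, rfl⟩ := Fin.exists_succAbove_eq (x := b) (y := i.succ)
        (fun e => h3 (by rw [← hb, e]))
      exact ⟨a, hb⟩
  rw [← neg_eq_zero, ← h, ← Finset.sum_neg_distrib]
  conv_lhs => rw [hJf]
  rw [Finset.sum_map]
  refine Finset.sum_congr rfl fun i _ => ?_
  rw [← hJf, RelEmbedding.coe_toEmbedding]
  have h3 := key i
  simp only [hg] at h3
  rw [h3, rankBelow_orderEmbOfFin, reducedEntry]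
  ring

lemma minor_eq_det_vandermonde {n : ℕ} (g : Fin (k + 1) → Fin n) :
    ((vandermondeMatrix K n k).submatrix id g).det =
      (Matrix.vandermonde fun i => (X (g i) : MvPolynomial (Fin n) K)).det := by
  rw [← Matrix.det_transpose]
  rfl

lemma det_vandermonde_cons_zero_mem (g : Fin k → Fin (m + 1)) :
    (Matrix.vandermonde fun i : Fin (k + 1) =>
      (X ((Fin.cons 0 g : Fin (k + 1) → Fin (m + 1)) i) : MvPolynomial (Fin (m + 1)) K)).det ∈
      Ideal.span (Set.range fun J : {J : Finset (Fin m) // J.card = k} =>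
        vanProd K (cone J.1)) := by
  classical
  by_cases hg : Function.Injective (Fin.cons 0 g : Fin (k + 1) → Fin (m + 1))
  · obtain ⟨u, hu⟩ := exists_sign_det_vandermonde_X (K := K) hg
    set S := Finset.univ.image (Fin.cons 0 g : Fin (k + 1) → Fin (m + 1)) with hS
    set J := Finset.univ.filter fun j : Fin m => j.succ ∈ S with hJ
    have h0 : S = cone J := cone_ext (Finset.mem_image.mpr ⟨0, by simp⟩) fun j => by simp [hJ]
    have hcard : J.card = k := by
      have h1 : S.card = k + 1 := by
        rw [hS, Finset.card_image_of_injective _ hg, Finset.card_univ, Fintype.card_fin]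
      rw [h0, cone, Finset.card_insert_of_notMem (by simp), Finset.card_map] at h1
      omega
    rw [hu, h0, zsmul_eq_mul]
    exact Ideal.mul_mem_left _ _ (Ideal.subset_span ⟨⟨J, hcard⟩, rfl⟩)
  · simp only [Function.Injective, not_forall] at hg
    obtain ⟨a, b, hab, hne⟩ := hg
    rw [Matrix.det_zero_of_row_eq hne]
    · exact zero_mem _
    · funext r
      simp [Matrix.vandermonde_apply, hab]

lemma vanIdeal_eq_span (hk : 1 ≤ k) :
    vanIdeal K (m + 1) k = Ideal.span (Set.range fun J : {J : Finset (Fin m) // J.card = k} =>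
      vanProd K (cone J.1)) := by
  refine le_antisymm (Ideal.span_le.mpr ?_) (Ideal.span_le.mpr ?_)
  · rintro _ ⟨g, rfl⟩
    rw [minor_eq_det_vandermonde]
    set h : Fin (k + 2) → Fin (m + 1) := Fin.cons 0 g with hh
    have hsum := sum_pow_mul_det_vandermonde
      (fun c => (X (h c) : MvPolynomial (Fin (m + 1)) K)) (Nat.zero_le k)
    rw [Fin.sum_univ_succ] at hsum
    simp only [pow_zero, mul_one, Fin.val_zero, one_mul, Fin.zero_succAbove] at hsum
    have hfst : (fun i : Fin (k + 1) => (X (h i.succ) : MvPolynomial (Fin (m + 1)) K)) =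
        fun i => X (g i) := by
      simp [hh]
    rw [hfst] at hsum
    rw [eq_neg_of_add_eq_zero_left hsum]
    refine neg_mem (sum_mem fun i _ => Ideal.mul_mem_left _ _ ?_)
    obtain ⟨k, rfl⟩ : ∃ l, k = l + 1 := ⟨k - 1, by omega⟩
    have hi : ∀ a, h (i.succ.succAbove a) =
        (Fin.cons 0 (fun b => g (i.succAbove b)) : Fin (k + 1 + 1) → Fin (m + 1)) a := by
      intro a
      cases a using Fin.cases with
      | zero => simp [hh]
      | succ a => simp [hh]
    simp only [hi]
    exact det_vandermonde_cons_zero_mem _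
  · rintro _ ⟨⟨J, hJ⟩, rfl⟩
    refine Ideal.subset_span ⟨⟨_, (strictMono_cons_succ hJ).injective⟩, ?_⟩
    rw [Function.Embedding.coeFn_mk, minor_eq_det_vandermonde,
      det_vandermonde_X_of_strictMono (strictMono_cons_succ hJ), image_cons_succ]

end Vandermonde

section LeadingTerm

variable {m k : ℕ} {K : Type*} [Field K]

/-- `p` is the sum of the monomial with exponent `γ` and a combination of monomials of smaller
weight. -/
def HasLead (p : MvPolynomial (Fin (m + 1)) K) (γ : Fin (m + 1) →₀ ℕ) : Prop :=
  p - monomial γ 1 ∈ Submodule.span K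
    ((fun ρ => monomial ρ (1 : K)) '' {ρ | varWeight ρ < varWeight γ})

lemma hasLead_monomial (γ : Fin (m + 1) →₀ ℕ) : HasLead (monomial γ (1 : K)) γ := by
  simp [HasLead]

lemma hasLead_X_sub_X {a b : Fin (m + 1)} (h : a < b) :
    HasLead (X b - X a : MvPolynomial (Fin (m + 1)) K) (Finsupp.single b 1) := by
  rw [HasLead, X, X, sub_sub_cancel_left]
  refine neg_mem (Submodule.subset_span ⟨_, ?_, rfl⟩)
  simpa [varWeight_single] using h

lemma monomial_mem_span_mul {p q : MvPolynomial (Fin (m + 1)) K} {s t u : Set (Fin (m + 1) →₀ ℕ)}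
    (hp : p ∈ Submodule.span K ((fun ρ => monomial ρ (1 : K)) '' s))
    (hq : q ∈ Submodule.span K ((fun ρ => monomial ρ (1 : K)) '' t))
    (h : ∀ ρ ∈ s, ∀ ν ∈ t, ρ + ν ∈ u) :
    p * q ∈ Submodule.span K ((fun ρ => monomial ρ (1 : K)) '' u) := by
  have h1 := Submodule.mul_mem_mul hp hq
  rw [Submodule.span_mul_span] at h1
  refine Submodule.span_mono ?_ h1
  rintro _ ⟨_, ⟨ρ, hρ, rfl⟩, _, ⟨ν, hν, rfl⟩, rfl⟩
  exact ⟨ρ + ν, h ρ hρ ν hν, by simp [monomial_mul]⟩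

lemma HasLead.mul {p q : MvPolynomial (Fin (m + 1)) K} {γ δ : Fin (m + 1) →₀ ℕ}
    (hp : HasLead p γ) (hq : HasLead q δ) : HasLead (p * q) (γ + δ) := by
  have hq' : q ∈ Submodule.span K
      ((fun ρ => monomial ρ (1 : K)) '' {ρ | varWeight ρ ≤ varWeight δ}) := by
    rw [← sub_add_cancel q (monomial δ 1)]
    refine add_mem (Submodule.span_mono (Set.image_mono ?_) hq)
      (Submodule.subset_span ⟨δ, le_refl (varWeight δ), rfl⟩)
    exact fun ρ (h : varWeight ρ < varWeight δ) => h.le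
  have hm : monomial γ (1 : K) ∈ Submodule.span K
      ((fun ρ => monomial ρ (1 : K)) '' {γ}) := Submodule.subset_span ⟨γ, rfl, rfl⟩
  have e : p * q - monomial (γ + δ) 1 =
      (p - monomial γ 1) * q + monomial γ 1 * (q - monomial δ 1) := by
    have : monomial (γ + δ) (1 : K) = monomial γ 1 * monomial δ 1 := by
      rw [monomial_mul, one_mul]
    rw [this]
    ring
  rw [HasLead, e]
  refine add_mem (monomial_mem_span_mul hp hq' ?_) (monomial_mem_span_mul hm hq ?_)
  · intro ρ hρ ν hν
    simp only [Set.mem_ofPred_eq, varWeight_add] at *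
    omega
  · rintro _ rfl ν hν
    simp only [Set.mem_ofPred_eq, varWeight_add] at *
    omega

lemma HasLead.prod {ι : Type*} (s : Finset ι) (p : ι → MvPolynomial (Fin (m + 1)) K)
    (γ : ι → Fin (m + 1) →₀ ℕ) (h : ∀ i ∈ s, HasLead (p i) (γ i)) :
    HasLead (∏ i ∈ s, p i) (∑ i ∈ s, γ i) := by
  classical
  induction s using Finset.induction_on with
  | empty => simpa using hasLead_monomial (K := K) (0 : Fin (m + 1) →₀ ℕ)
  | insert i s hi ih =>
    rw [Finset.prod_insert hi, Finset.sum_insert hi]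
    exact (h i (Finset.mem_insert_self _ _)).mul
      (ih fun j hj => h j (Finset.mem_insert_of_mem hj))

/-- The exponent of the leading monomial of `vanProd`. -/
noncomputable def leadExp {n : ℕ} (S : Finset (Fin n)) : Fin n →₀ ℕ :=
  ∑ b ∈ S, Finsupp.single b (rankBelow S b)

lemma leadExp_apply {n : ℕ} (S : Finset (Fin n)) (c : Fin n) :
    leadExp S c = if c ∈ S then rankBelow S c else 0 := by
  classical
  simp [leadExp, Finsupp.finsetSum_apply, Finsupp.single_apply]

lemma hasLead_vanProd (S : Finset (Fin (m + 1))) : HasLead (vanProd K S) (leadExp S) := by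
  refine HasLead.prod _ _ _ fun b _ => ?_
  have : Finsupp.single b (rankBelow S b) = ∑ a ∈ S with a < b, Finsupp.single b 1 := by
    rw [Finset.sum_const, ← rankBelow, Finsupp.smul_single]
    simp
  rw [this]
  exact HasLead.prod _ _ _ fun a ha => hasLead_X_sub_X (Finset.mem_filter.mp ha).2

lemma rankBelow_cone (J : Finset (Fin m)) (j : Fin m) :
    rankBelow (cone J) j.succ = rankBelow J j + 1 := by
  have : (cone J).filter (· < j.succ) =
      insert 0 ((J.filter (· < j)).map (Fin.succEmb m)) := by
    ext c
    cases c using Fin.cases with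
    | zero => simp [zero_mem_cone]
    | succ c => simp [succ_mem_cone]
  rw [rankBelow, this, Finset.card_insert_of_notMem (by simp), Finset.card_map, rankBelow]

lemma leadExp_cone_succ (J : Finset (Fin m)) (j : Fin m) :
    leadExp (cone J) j.succ = if j ∈ J then rankBelow J j + 1 else 0 := by
  simp only [leadExp_apply, succ_mem_cone, rankBelow_cone]

lemma sum_rankBelow {n : ℕ} (S : Finset (Fin n)) :
    ∑ b ∈ S, rankBelow S b = S.card * (S.card - 1) / 2 := by
  have hS : Finset.univ.map (S.orderEmbOfFin rfl).toEmbedding = S := by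
    rw [Finset.map_eq_image]
    simp
  conv_lhs => enter [1]; rw [← hS]
  rw [Finset.sum_map]
  simp only [RelEmbedding.coe_toEmbedding, rankBelow_orderEmbOfFin]
  rw [Fin.sum_univ_eq_sum_range (fun i => i), Finset.sum_range_id]

lemma isHomogeneous_vanProd {n : ℕ} (S : Finset (Fin n)) :
    (vanProd K S).IsHomogeneous (S.card * (S.card - 1) / 2) := by
  rw [← sum_rankBelow]
  refine IsHomogeneous.prod _ _ _ fun b _ => ?_
  have : rankBelow S b = ∑ a ∈ S with a < b, 1 := by
    rw [Finset.sum_const, smul_eq_mul, mul_one, rankBelow]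
  rw [this]
  exact IsHomogeneous.prod _ _ _ fun a _ => (isHomogeneous_X _ _).sub (isHomogeneous_X _ _)

lemma card_cone (J : Finset (Fin m)) : (cone J).card = J.card + 1 := by
  rw [cone, Finset.card_insert_of_notMem (by simp), Finset.card_map]

lemma isHomogeneous_vanProd_cone {J : Finset (Fin m)} (hJ : J.card = k) :
    (vanProd K (cone J)).IsHomogeneous (k * (k + 1) / 2) := by
  have := isHomogeneous_vanProd (K := K) (cone J)
  rw [card_cone, hJ, Nat.add_sub_cancel, mul_comm] at this
  exact this

end LeadingTerm

section Augmentation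

variable {m k : ℕ} {K : Type*} [Field K]

/-- The last map of the Eagon–Northcott complex, given by the maximal minors. -/
noncomputable def minorMap (K : Type*) [Field K] (m k : ℕ) :
    (cells m k 0 →₀ MvPolynomial (Fin (m + 1)) K) →ₗ[MvPolynomial (Fin (m + 1)) K]
      MvPolynomial (Fin (m + 1)) K :=
  Finsupp.linearCombination _ fun p => vanProd K (cone p.1.1)

lemma minorMap_single (p : cells m k 0) (r : MvPolynomial (Fin (m + 1)) K) :
    minorMap K m k (Finsupp.single p r) = r * vanProd K (cone p.1.1) := by
  rw [minorMap, Finsupp.linearCombination_single, smul_eq_mul]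

lemma range_minorMap (hk : 1 ≤ k) :
    LinearMap.range (minorMap K m k) = vanIdeal K (m + 1) k := by
  rw [vanIdeal_eq_span hk, minorMap, Finsupp.range_linearCombination]
  congr 1
  ext r
  constructor
  · rintro ⟨p, rfl⟩
    exact ⟨⟨p.1.1, p.2.1⟩, rfl⟩
  · rintro ⟨⟨J, hJ⟩, rfl⟩
    exact ⟨⟨(J, 0), hJ, by simp⟩, rfl⟩

lemma minorMap_enMap (z : cells m k (0 + 1) →₀ MvPolynomial (Fin (m + 1)) K) :
    minorMap K m k (enMap K m k 0 z) = 0 := by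
  suffices h : minorMap K m k ∘ₗ enMap K m k 0 = 0 from LinearMap.congr_fun h z
  ext1 p
  ext1
  simp only [LinearMap.comp_apply, Finsupp.lsingle_apply, enMap_single, map_sum, map_smul,
    minorMap_single, one_mul, smul_eq_mul, LinearMap.zero_apply]
  refine (Finset.sum_attach (faces p.1)
    (fun x => incidence K p.1 x * vanProd K (cone (face p.1 x).1))).trans ?_
  rw [faces, Finset.sum_product_right]
  exact Finset.sum_eq_zero fun t _ => sum_incidence_mul_vanProd p.2.1 t

/-- The matching between the terms of the Eagon–Northcott complex in homological degree one and the
monomials. -/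
def MinorMatch (σ : Σ _ : cells m k 0, Fin (m + 1) →₀ ℕ) (γ : Fin (m + 1) →₀ ℕ) : Prop :=
  γ = σ.2 + leadExp (cone σ.1.1.1) ∧
    ∀ c, c ∉ σ.1.1.1 → rankBelow σ.1.1.1 c < k → σ.2 c.succ ≤ rankBelow σ.1.1.1 c

lemma MinorMatch.subset {σ σ' : Σ _ : cells m k 0, Fin (m + 1) →₀ ℕ} {γ : Fin (m + 1) →₀ ℕ}
    (h : MinorMatch σ γ) (h' : MinorMatch σ' γ) {c : Fin m} (hc : c ∈ σ.1.1.1)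
    (hlt : ∀ d < c, d ∈ σ.1.1.1 ↔ d ∈ σ'.1.1.1) : c ∈ σ'.1.1.1 := by
  by_contra hcon
  have h1 := rankBelow_lt_card hc
  rw [σ.1.2.1, add_zero] at h1
  have h2 := rankBelow_congr hlt
  have h3 := h'.2 c hcon (h2 ▸ h1)
  have h4 := DFunLike.congr_fun (h.1.symm.trans h'.1) c.succ
  rw [Finsupp.add_apply, Finsupp.add_apply, leadExp_cone_succ, leadExp_cone_succ, if_pos hc,
    if_neg hcon] at h4
  omega

lemma MinorMatch.unique {σ σ' : Σ _ : cells m k 0, Fin (m + 1) →₀ ℕ} {γ : Fin (m + 1) →₀ ℕ}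
    (h : MinorMatch σ γ) (h' : MinorMatch σ' γ) : σ = σ' := by
  have hJ : ∀ c, c ∈ σ.1.1.1 ↔ c ∈ σ'.1.1.1 := by
    intro c
    induction c using WellFoundedLT.induction with
    | _ c ih =>
      exact ⟨fun hc => h.subset h' hc ih, fun hc => h'.subset h hc fun d hd => (ih d hd).symm⟩
  have hp : σ.1 = σ'.1 := by
    refine Subtype.ext (Prod.ext (Finset.ext hJ) (funext fun s => ?_))
    have h1 := (Finset.sum_eq_zero_iff.mp σ.1.2.2) s (Finset.mem_univ _)
    have h2 := (Finset.sum_eq_zero_iff.mp σ'.1.2.2) s (Finset.mem_univ _)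
    rw [h1, h2]
  obtain ⟨p, α⟩ := σ
  obtain ⟨p', α'⟩ := σ'
  obtain rfl := hp
  have := add_right_cancel (h.1.symm.trans h'.1)
  rw [show α = α' from this]

lemma isTriangular_minorMap (K : Type*) [Field K] (m k : ℕ) :
    IsTriangular (termBasis (Fin (m + 1)) K (cells m k 0)) (basisMonomials (Fin (m + 1)) K)
      ((minorMap K m k).restrictScalars K) MinorMatch varWeight := by
  rintro ⟨p, α⟩ γ ⟨rfl, -⟩
  refine ⟨1, one_ne_zero, ?_⟩
  rw [LinearMap.restrictScalars_apply, termBasis_apply, minorMap_single, one_smul,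
    coe_basisMonomials]
  exact (hasLead_monomial α).mul (hasLead_vanProd _)

lemma ker_minorMap (K : Type*) [Field K] (m k : ℕ) :
    LinearMap.ker (minorMap K m k) = LinearMap.range (enMap K m k 0) := by
  ext z
  rw [LinearMap.mem_ker, LinearMap.mem_range]
  constructor
  · intro hz
    obtain ⟨w, u, hu, e⟩ := (isTriangular_enMap K m k 0).exists_add z
    have hu0 : u = 0 := by
      refine (isTriangular_minorMap K m k).eq_zero (fun τ τ' σ h h' => h.unique h')
        (Submodule.span_mono (Set.image_mono fun σ hσ => ?_) hu) ?_
      · rw [Set.mem_ofPred_eq, ← exists_matchedAt_iff_exists_termMatch] at hσ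
        exact ⟨_, rfl, not_exists_matchedAt_zero σ.1.2 hσ⟩
      · have h1 := congrArg (minorMap K m k) e
        rw [map_add, LinearMap.restrictScalars_apply, minorMap_enMap, zero_add, hz] at h1
        exact h1
    rw [hu0, add_zero] at e
    exact ⟨w, e⟩
  · rintro ⟨w, rfl⟩
    exact minorMap_enMap w

end Augmentation

section Betti

variable {m k : ℕ} {K : Type*} [Field K]

lemma homogeneousComponent_mem_vanIdeal (hk : 1 ≤ k) {r : MvPolynomial (Fin (m + 1)) K}
    (hr : r ∈ vanIdeal K (m + 1) k) (j : ℕ) :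
    homogeneousComponent j r ∈ vanIdeal K (m + 1) k := by
  let _ := gradedAlgebra (σ := Fin (m + 1)) (R := K)
  refine (mem_iff_homogeneousComponent_mem ?_ r).mp hr j
  rw [vanIdeal_eq_span hk]
  refine Ideal.homogeneous_span _ _ ?_
  rintro _ ⟨⟨J, hJ⟩, rfl⟩
  exact ⟨_, (mem_homogeneousSubmodule _ _).mpr (isHomogeneous_vanProd_cone hJ)⟩

/-- The degree of a generator of the Eagon–Northcott complex. -/
def cellDegree (p : Finset (Fin m) × (Fin k → ℕ)) : ℕ :=
  k * (k + 1) / 2 + ∑ t : Fin k, (t.val + 1) * p.2 t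

lemma cellDegree_face {p : Finset (Fin m) × (Fin k → ℕ)} {x : Fin m × Fin k}
    (hx : x ∈ faces p) : x.2.val + 1 + cellDegree (face p x) = cellDegree p := by
  classical
  have hs := (mem_faces.mp hx).2
  have h0 := Finset.add_sum_erase Finset.univ
    (fun t : Fin k => (t.val + 1) * (face p x).2 t) (Finset.mem_univ x.2)
  have h1 := Finset.add_sum_erase Finset.univ
    (fun t : Fin k => (t.val + 1) * p.2 t) (Finset.mem_univ x.2)
  have h2 : ∑ t ∈ Finset.univ.erase x.2, (t.val + 1) * (face p x).2 t =
      ∑ t ∈ Finset.univ.erase x.2, (t.val + 1) * p.2 t :=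
    Finset.sum_congr rfl fun t ht => by simp [face, (Finset.mem_erase.mp ht).1]
  obtain ⟨b, hb⟩ := Nat.exists_eq_succ_of_ne_zero hs
  have h3 : (face p x).2 x.2 = b := by simp [face, hb]
  rw [cellDegree, cellDegree, ← h0, ← h1, h2]
  rw [h3, hb, Nat.succ_eq_add_one]
  ring

lemma single_one_eq_termBasis {σ B : Type*} (b : B) :
    (Finsupp.single b 1 : B →₀ MvPolynomial σ K) = termBasis σ K B ⟨b, 0⟩ := by
  rw [termBasis_apply]
  rfl

lemma termBasis_mem_irrelevantPart {σ B : Type*} (b : B) {α : σ →₀ ℕ} (hα : α ≠ 0) :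
    termBasis σ K B ⟨b, α⟩ ∈ irrelevantPart σ K B := by
  classical
  rw [mem_irrelevantPart]
  intro c
  rw [termBasis_apply, Finsupp.single_apply]
  split_ifs
  · rw [constantCoeff_eq, coeff_monomial, if_neg hα]
  · simp

lemma isGradedMap_enMap (i : ℕ) :
    IsGradedMap (fun p : cells m k (i + 1) => cellDegree p.1)
      (fun p : cells m k i => cellDegree p.1) (enMap K m k i) := by
  intro p
  rw [single_one_eq_termBasis, enMap_termBasis]
  refine sum_mem fun x _ => Submodule.smul_mem _ _ (sub_mem ?_ ?_)
  all_goals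
    refine Submodule.subset_span ⟨_, ?_, rfl⟩
    have := cellDegree_face x.2
    simp only [Set.mem_ofPred_eq, zero_add, Finsupp.degree_single, Set.mem_singleton_iff]
    omega

lemma enMap_single_mem_irrelevantPart (i : ℕ) (p : cells m k (i + 1)) :
    enMap K m k i (Finsupp.single p 1) ∈ irrelevantPart (Fin (m + 1)) K (cells m k i) := by
  rw [single_one_eq_termBasis, enMap_termBasis]
  refine sum_mem fun x _ => Submodule.smul_of_tower_mem _ _ (sub_mem ?_ ?_)
  all_goals exact termBasis_mem_irrelevantPart _ (by simp)

/-- The map `minorMap`, with the free module on one generator as its codomain. -/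
noncomputable def minorDiff (K : Type*) [Field K] (m k : ℕ) :
    (cells m k 0 →₀ MvPolynomial (Fin (m + 1)) K) →ₗ[MvPolynomial (Fin (m + 1)) K]
      (Unit →₀ MvPolynomial (Fin (m + 1)) K) :=
  Finsupp.lsingle () ∘ₗ minorMap K m k

lemma ker_minorDiff : LinearMap.ker (minorDiff K m k) = LinearMap.range (enMap K m k 0) := by
  rw [← ker_minorMap, minorDiff, LinearMap.ker_comp_of_ker_eq_bot]
  exact LinearMap.ker_eq_bot.mpr (Finsupp.single_injective ())

lemma degree_eq_of_coeff_minorDiff_ne_zero (p : cells m k 0) (b : Unit) {α : Fin (m + 1) →₀ ℕ}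
    (hα : coeff α (minorDiff K m k (Finsupp.single p 1) b) ≠ 0) :
    α.degree = k * (k + 1) / 2 := by
  rw [minorDiff, LinearMap.comp_apply, minorMap_single, one_mul, Finsupp.lsingle_apply,
    Finsupp.single_eq_same] at hα
  exact degree_eq_of_isHomogeneous (isHomogeneous_vanProd_cone p.2.1) hα

lemma isGradedMap_minorDiff :
    IsGradedMap (fun p : cells m k 0 => cellDegree p.1) (fun _ => 0) (minorDiff K m k) := by
  intro p
  rw [mem_degreePart]
  intro b α hα
  have h2 : ∑ t : Fin k, (t.val + 1) * p.1.2 t = 0 := Finset.sum_eq_zero fun t _ => by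
    rw [Finset.sum_eq_zero_iff.mp p.2.2 t (Finset.mem_univ _), mul_zero]
  have h1 := degree_eq_of_coeff_minorDiff_ne_zero p b hα
  change α.degree + 0 = k * (k + 1) / 2 + ∑ t : Fin k, (t.val + 1) * p.1.2 t
  rw [h1, h2]

lemma minorDiff_single_mem_irrelevantPart (hk : 1 ≤ k) (p : cells m k 0) :
    minorDiff K m k (Finsupp.single p 1) ∈ irrelevantPart (Fin (m + 1)) K Unit := by
  rw [mem_irrelevantPart]
  intro b
  rw [constantCoeff_eq]
  by_contra hα
  have h1 := degree_eq_of_coeff_minorDiff_ne_zero p b hα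
  have h2 : 1 * (1 + 1) / 2 ≤ k * (k + 1) / 2 := by gcongr
  rw [map_zero] at h1
  omega

/-- The augmentation of the Eagon–Northcott complex. -/
noncomputable def enAugmentation (K : Type*) [Field K] (m k : ℕ) :
    (Unit →₀ MvPolynomial (Fin (m + 1)) K) →ₗ[MvPolynomial (Fin (m + 1)) K]
      MvPolynomial (Fin (m + 1)) K ⧸ vanIdeal K (m + 1) k :=
  Submodule.mkQ (vanIdeal K (m + 1) k) ∘ₗ Finsupp.lapply ()

lemma enAugmentation_single (r : MvPolynomial (Fin (m + 1)) K) :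
    enAugmentation K m k (Finsupp.single () r) = Ideal.Quotient.mk _ r := by
  rw [enAugmentation, LinearMap.comp_apply, Finsupp.lapply_apply, Finsupp.single_eq_same]
  rfl

lemma ker_enAugmentation (hk : 1 ≤ k) :
    LinearMap.ker (enAugmentation K m k) = LinearMap.range (minorDiff K m k) := by
  ext z
  obtain ⟨r, rfl⟩ : ∃ r, z = Finsupp.single () r := ⟨z (), Finsupp.unique_ext (by simp)⟩
  rw [LinearMap.mem_ker, enAugmentation_single, Ideal.Quotient.eq_zero_iff_mem,
    ← range_minorMap hk]
  constructor
  · rintro ⟨w, rfl⟩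
    exact ⟨w, rfl⟩
  · rintro ⟨w, hw⟩
    exact ⟨w, Finsupp.single_injective () hw⟩

/-- The generators of the Eagon–Northcott complex. -/
def enIndex (m k : ℕ) : ℕ → Type
  | 0 => Unit
  | i + 1 => cells m k i

/-- The degrees of the generators of the Eagon–Northcott complex. -/
def enDegree (m k : ℕ) : ∀ i, enIndex m k i → ℕ
  | 0 => fun _ => 0
  | i + 1 => fun p : cells m k i => cellDegree p.1

/-- The differentials of the Eagon–Northcott complex. -/
noncomputable def enDiff (K : Type*) [Field K] (m k : ℕ) :
    ∀ i, (enIndex m k (i + 1) →₀ MvPolynomial (Fin (m + 1)) K) →ₗ[MvPolynomial (Fin (m + 1)) K]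
      (enIndex m k i →₀ MvPolynomial (Fin (m + 1)) K)
  | 0 => minorDiff K m k
  | i + 1 => enMap K m k i

lemma finite_cells (m k i : ℕ) : Finite (cells m k i) := by
  have h : cells m k i ⊆ Set.univ ×ˢ Set.Iic (fun _ => i) := by
    rintro ⟨J, a⟩ ⟨-, h⟩
    refine ⟨trivial, fun s => ?_⟩
    rw [← h]
    exact Finset.single_le_sum (f := a) (fun _ _ => Nat.zero_le _) (Finset.mem_univ s)
  exact (Set.finite_univ.prod (Set.finite_Iic _)).subset h

lemma isMinimalGradedResolution_en (K : Type*) [Field K] (m : ℕ) (hk : 1 ≤ k) :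
    IsMinimalGradedResolution (vanIdeal K (m + 1) k) (enIndex m k) (enDegree m k)
      (enDiff K m k) (enAugmentation K m k) where
  surjective := by
    intro y
    obtain ⟨r, rfl⟩ := Ideal.Quotient.mk_surjective y
    exact ⟨_, enAugmentation_single r⟩
  ker_augmentation := ker_enAugmentation hk
  exact
    | 0 => ker_minorDiff
    | i + 1 => ker_enMap K m k i
  graded
    | 0 => isGradedMap_minorDiff
    | i + 1 => isGradedMap_enMap i
  minimal
    | 0 => minorDiff_single_mem_irrelevantPart hk
    | i + 1 => enMap_single_mem_irrelevantPart i
  graded_augmentation _ := ⟨1, isHomogeneous_one _ _, enAugmentation_single 1⟩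
  finite
    | 0, j => inferInstanceAs (Finite {b : Unit // 0 = j})
    | i + 1, j =>
      have := finite_cells m k i
      inferInstanceAs (Finite {p : cells m k i // cellDegree p.1 = j})

lemma card_enDegree_eq (m k i j : ℕ) :
    Nat.card {p : enIndex m k (i + 1) // enDegree m k (i + 1) p = j} =
      pCount k i ((j : ℤ) - (k : ℤ) * (k + 1) / 2) * Nat.choose m (k + i) := by
  have hJ : Nat.card {J : Finset (Fin m) // J.card = k + i} = Nat.choose m (k + i) := by
    rw [Nat.card_eq_fintype_card, Fintype.card_finset_len, Fintype.card_fin]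
  rw [pCount, ← hJ, ← Nat.card_prod]
  have hiff : ∀ a : Fin k → ℕ, k * (k + 1) / 2 + ∑ t : Fin k, (t.val + 1) * a t = j ↔
      ∑ t : Fin k, ((t.val : ℤ) + 1) * (a t : ℤ) = (j : ℤ) - (k : ℤ) * (k + 1) / 2 := by
    intro a
    rw [← Nat.cast_inj (R := ℤ), eq_sub_iff_add_eq, add_comm]
    push_cast
    rfl
  refine Nat.card_congr
    { toFun := fun p => ⟨⟨(show cells m k i from p.1).1.2, p.1.2.2, (hiff _).mp p.2⟩,
        ⟨(show cells m k i from p.1).1.1, p.1.2.1⟩⟩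
      invFun := fun q => ⟨⟨(q.2.1, q.1.1), q.2.2, q.1.2.1⟩, (hiff _).mpr q.1.2.2⟩
      left_inv := fun p => rfl
      right_inv := fun q => rfl }

lemma card_bettiBasis_eq (β : ℕ → ℕ → ℕ) (i j : ℕ) :
    Nat.card {b : bettiBasis β i // b.1.1 = j} = β i j := by
  rw [← Nat.card_fin (β i j)]
  refine Nat.card_congr
    { toFun := fun b => ⟨b.1.1.2, b.1.2.trans_eq (by rw [b.2])⟩
      invFun := fun t => ⟨⟨(j, t), t.2⟩, rfl⟩
      left_inv := ?_
      right_inv := fun t => rfl }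
  rintro ⟨b, rfl⟩
  rfl

lemma IsMinimalFreeResolution.exists_isMinimalGradedResolution {n : ℕ}
    {I : Ideal (MvPolynomial (Fin n) K)} {β : ℕ → ℕ → ℕ} (h : IsMinimalFreeResolution K I β) :
    ∃ d ε, IsMinimalGradedResolution I (bettiBasis β) (fun _ b => b.1.1) d ε := by
  obtain ⟨d, ε, h1, h2, h3, h4, h5, h6⟩ := h
  refine ⟨d, ε, h1, h2, h3, ?_, fun i b => mem_irrelevantPart.mpr (h5 i b), ?_, ?_⟩
  · intro i b
    rw [mem_degreePart]
    intro c α hα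
    rcases h4 i b c with h0 | ⟨hle, hhom⟩
    · simp [h0] at hα
    · have := degree_eq_of_isHomogeneous hhom hα
      dsimp only
      rw [Set.mem_singleton_iff]
      omega
  · intro b
    obtain ⟨r, hr, e⟩ := h6 b
    exact ⟨r, hr, e.symm⟩
  · intro i j
    refine Finite.of_equiv (Fin (β i j))
      { toFun := fun t => ⟨⟨(j, t), t.2⟩, rfl⟩
        invFun := fun b => ⟨b.1.1.2, b.1.2.trans_eq (by rw [b.2])⟩
        left_inv := fun t => rfl
        right_inv := ?_ }
    rintro ⟨b, rfl⟩
    rfl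

end Betti

/-- For `i ≥ 1`, the graded Betti numbers of `R ⧸ I_{n,k}` are
`β_{i,j} = p^k_{i-1, j - k(k+1)/2} · C(n-1, k+i-1)` (with `p^m_{0,s} = δ_{0,s}`). -/
theorem vanIdeal_bettiNumbers (K : Type*) [Field K] (n k : ℕ) (hk : 1 ≤ k) (hn : k < n)
    (β : ℕ → ℕ → ℕ) (hβ : IsMinimalFreeResolution K (vanIdeal K n k) β)
    (i j : ℕ) (hi : 1 ≤ i) :
    β i j = pCount k (i - 1) ((j : ℤ) - (k : ℤ) * (k + 1) / 2) *
      Nat.choose (n - 1) (k + i - 1) := by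
  obtain ⟨m, rfl⟩ : ∃ m, n = m + 1 := ⟨n - 1, by omega⟩
  obtain ⟨i, rfl⟩ : ∃ l, i = l + 1 := ⟨i - 1, by omega⟩
  obtain ⟨d, ε, h⟩ := hβ.exists_isMinimalGradedResolution
  rw [← card_bettiBasis_eq β (i + 1) j, h.card_degree_eq (isMinimalGradedResolution_en K m hk)
    (fun r hr j => homogeneousComponent_mem_vanIdeal hk hr j), card_enDegree_eq]
  rfl
end

section
/- Let K be a field and, for m > l ≥ 1, let I_{m,l} ⊆ K[x₁,…,x_m] be the ideal generated by the (l+1)-minors of the (l+1)×m Vandermonde matrix. For integers n − 1 > k ≥ 2 and all j, the first graded Betti numbers satisfy β_{1,j}(R/I_{n,k}) = β_{1,j−k}(R'/I_{n−1,k−1}) + β_{1,j}(R'/I_{n−1,k}), where R = K[x₁,…,xₙ] and R' = K[x₁,…,x_{n−1}]. -/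
open MvPolynomial

namespace MvPolynomial

variable {σ K : Type*} [Field K]

attribute [local instance] MvPolynomial.gradedAlgebra in
theorem homogeneousComponent_mul_of_lt {D e : ℕ} {g : MvPolynomial σ K} (hg : g.IsHomogeneous D)
    (h : e < D) (r : MvPolynomial σ K) : homogeneousComponent e (r * g) = 0 := by
  have := DirectSum.coe_decompose_mul_of_right_mem_of_not_le
    (𝒜 := homogeneousSubmodule σ K) (a := r) (b := g) (i := D) (n := e) hg (by omega)
  rwa [← decomposition.decompose'_apply]

attribute [local instance] MvPolynomial.gradedAlgebra in
theorem homogeneousComponent_mul_self {D : ℕ} {g : MvPolynomial σ K} (hg : g.IsHomogeneous D)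
    (r : MvPolynomial σ K) : homogeneousComponent D (r * g) = constantCoeff r • g := by
  have := DirectSum.coe_decompose_mul_of_right_mem_of_le
    (𝒜 := homogeneousSubmodule σ K) (a := r) (b := g) (i := D) (n := D) hg le_rfl
  rw [← decomposition.decompose'_apply]
  refine this.trans ?_
  rw [Nat.sub_self]
  change (decomposition.decompose' r 0 : MvPolynomial σ K) * g = _
  rw [decomposition.decompose'_apply, homogeneousComponent_zero, smul_eq_C_mul]
  rfl

theorem homogeneousComponent_eq_zero_of_mem_span {D e : ℕ} {G : Set (MvPolynomial σ K)}
    (hG : ∀ g ∈ G, g.IsHomogeneous D) (h : e < D) {x : MvPolynomial σ K} (hx : x ∈ Ideal.span G) :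
    homogeneousComponent e x = 0 := by
  induction hx using Submodule.closure_induction with
  | zero => simp
  | add x y _ _ hx hy => simp [hx, hy]
  | smul_mem r x hx => exact homogeneousComponent_mul_of_lt (hG x hx) h r

theorem homogeneousComponent_mem_span {D : ℕ} {G : Set (MvPolynomial σ K)}
    (hG : ∀ g ∈ G, g.IsHomogeneous D) {x : MvPolynomial σ K} (hx : x ∈ Ideal.span G) :
    homogeneousComponent D x ∈ Submodule.span K G := by
  induction hx using Submodule.closure_induction with
  | zero => simp
  | add x y _ _ hx hy => simpa using add_mem hx hy
  | smul_mem r x hx =>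
    rw [smul_eq_mul, homogeneousComponent_mul_self (hG x hx)]
    exact Submodule.smul_mem _ _ (Submodule.subset_span hx)

theorem IsHomogeneous.homogeneousComponent_eq {D : ℕ} {p : MvPolynomial σ K}
    (hp : p.IsHomogeneous D) : homogeneousComponent D p = p := by
  simp [homogeneousComponent_of_mem hp]

section MinimalGenerators

variable {ι : Type*} {f : ι → MvPolynomial σ K} {δ : ι → ℕ} {G : Set (MvPolynomial σ K)} {D : ℕ}

/-- A graded minimal generating family of an ideal generated in degree `D` contains no generator
of another degree, and it spans the same vector space of forms. -/
theorem degree_eq_and_span_eq_of_minimal (hf : ∀ b, (f b).IsHomogeneous (δ b))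
    (hspan : Ideal.span (Set.range f) = Ideal.span G) (hG : ∀ g ∈ G, g.IsHomogeneous D)
    (hmin : ∀ c : ι →₀ MvPolynomial σ K, Finsupp.linearCombination _ f c = 0 →
      ∀ b, constantCoeff (c b) = 0) :
    (∀ b, δ b = D) ∧ Submodule.span K G = Submodule.span K (Set.range f) := by
  have hfI (b) : f b ∈ Ideal.span G := hspan ▸ Ideal.subset_span ⟨b, rfl⟩
  have hge (b) : D ≤ δ b := by
    by_contra! h
    have h0 : f b = 0 := by
      rw [← (hf b).homogeneousComponent_eq]
      exact homogeneousComponent_eq_zero_of_mem_span hG h (hfI b)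
    simpa using hmin (Finsupp.single b 1) (by simp [h0]) b
  have hGle : G ⊆ Submodule.span K (f '' {b | δ b = D}) := by
    intro g hg
    have hgI : g ∈ Ideal.span (Set.range f) := hspan ▸ Ideal.subset_span hg
    obtain ⟨c, hc⟩ := Finsupp.mem_span_range_iff_exists_finsupp.mp hgI
    rw [← (hG g hg).homogeneousComponent_eq, ← hc, Finsupp.sum, map_sum]
    refine sum_mem fun b _ => ?_
    obtain h | h := (hge b).eq_or_lt
    · rw [smul_eq_mul, homogeneousComponent_mul_self (h ▸ hf b)]
      exact Submodule.smul_mem _ _ (Submodule.subset_span ⟨b, h.symm, rfl⟩)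
    · rw [smul_eq_mul, homogeneousComponent_mul_of_lt (hf b) h]
      exact zero_mem _
  have hdeg (b) : δ b = D := by
    by_contra h
    have hle : Ideal.span G ≤ Ideal.span (f '' {b | δ b = D}) :=
      Ideal.span_le.mpr fun g hg => Submodule.span_subset_span K _ _ (hGle hg)
    obtain ⟨l, hl, hlf⟩ := (Finsupp.mem_span_image_iff_linearCombination _).mp (hle (hfI b))
    have hlb : l b = 0 := by
      by_contra h'
      exact h (hl (Finsupp.mem_support_iff.mpr h'))
    have := hmin (Finsupp.single b 1 - l) (by simp [hlf]) b
    simp [hlb] at this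
  refine ⟨hdeg, le_antisymm (Submodule.span_le.mpr ?_) (Submodule.span_le.mpr ?_)⟩
  · exact hGle.trans (Submodule.span_mono (Set.image_subset_range _ _))
  · rintro _ ⟨b, rfl⟩
    rw [SetLike.mem_coe, ← (hdeg b ▸ hf b : (f b).IsHomogeneous D).homogeneousComponent_eq]
    exact homogeneousComponent_mem_span hG (hfI b)

theorem linearIndependent_of_minimal
    (hmin : ∀ c : ι →₀ MvPolynomial σ K, Finsupp.linearCombination _ f c = 0 →
      ∀ b, constantCoeff (c b) = 0) : LinearIndependent K f := by
  rw [linearIndependent_iff]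
  intro l hl
  ext b
  have := hmin (l.mapRange C (map_zero _)) (by
    rw [← hl, Finsupp.linearCombination_apply, Finsupp.linearCombination_apply,
      Finsupp.sum_mapRange_index (by simp)]
    simp [smul_eq_C_mul]) b
  simpa using this

end MinimalGenerators

end MvPolynomial

theorem constantCoeff_apply_eq_zero {σ K ι ι' : Type*} [Field K]
    {d : (ι →₀ MvPolynomial σ K) →ₗ[MvPolynomial σ K] (ι' →₀ MvPolynomial σ K)}
    (h : ∀ b b', constantCoeff (d (Finsupp.single b 1) b') = 0) (x : ι →₀ MvPolynomial σ K)
    (b' : ι') : constantCoeff (d x b') = 0 := by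
  induction x using Finsupp.induction_linear with
  | zero => simp
  | add x y hx hy => simp [hx, hy]
  | single b r =>
    rw [← mul_one r, ← smul_eq_mul, ← Finsupp.smul_single, map_smul]
    simp [h]

/-- The first differential of a minimal free resolution of `R ⧸ I` provides a graded minimal
generating family of `I`. -/
theorem IsMinimalFreeResolution.exists_minimal_generators {K : Type*} [Field K] {n : ℕ}
    {I : Ideal (MvPolynomial (Fin n) K)} {β : ℕ → ℕ → ℕ} (h : IsMinimalFreeResolution K I β)
    (hI : ∀ x ∈ I, constantCoeff x = 0) :
    ∃ f : bettiBasis β 1 → MvPolynomial (Fin n) K,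
      (∀ b, (f b).IsHomogeneous b.1.1) ∧ Ideal.span (Set.range f) = I ∧
      ∀ c : bettiBasis β 1 →₀ MvPolynomial (Fin n) K, Finsupp.linearCombination _ f c = 0 →
        ∀ b, constantCoeff (c b) = 0 := by
  obtain ⟨d, ε, hsurj, hker, hexact, hdeg, hmin, haug⟩ := h
  choose p hp hpε using haug
  replace hpε (b) : ε (Finsupp.single b 1) = Ideal.Quotient.mk I (p b) := (hpε b).symm
  have hε (x) : ε x = Ideal.Quotient.mk I (Finsupp.linearCombination _ p x) := by
    induction x using Finsupp.induction_linear with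
    | zero => simp
    | add x y hx hy => simp [hx, hy]
    | single b r =>
      rw [← mul_one r, ← smul_eq_mul, ← Finsupp.smul_single, map_smul, map_smul, hpε]
      simp only [Finsupp.linearCombination_single, smul_eq_mul, map_mul, one_mul]
      rfl
  have hcc (i x b) : constantCoeff (d i x b) = 0 := constantCoeff_apply_eq_zero (hmin i) x b
  have hker' (x) : ε x = 0 ↔ ∃ y, d 0 y = x := by
    rw [← LinearMap.mem_ker, hker, LinearMap.mem_range]
  obtain ⟨b₀, hb₀⟩ : ∃ b, constantCoeff (p b) ≠ 0 := by
    by_contra! hall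
    obtain ⟨x, hx⟩ := hsurj (Ideal.Quotient.mk I 1)
    rw [hε, Ideal.Quotient.eq] at hx
    have := hI _ hx
    simp [Finsupp.linearCombination_apply, Finsupp.sum, hall] at this
  have hb₀deg : b₀.1.1 = 0 := by
    by_contra h
    exact hb₀ ((hp b₀).coeff_eq_zero (by simpa using Ne.symm h))
  obtain ⟨u, hu⟩ : ∃ u, p b₀ = C u := by
    have := hp b₀
    rw [hb₀deg] at this
    exact ⟨_, totalDegree_eq_zero_iff_eq_C.mp (Nat.le_zero.mp this.totalDegree_le)⟩
  have hu0 : u ≠ 0 := by simpa [hu] using hb₀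
  have huniq (b) : b = b₀ := by
    by_contra hb
    obtain ⟨y, hy⟩ := (hker' (Finsupp.single b 1 - Finsupp.single b₀ (C u⁻¹ * p b))).mp (by
      rw [hε, map_sub, Finsupp.linearCombination_single, Finsupp.linearCombination_single, hu,
        smul_eq_mul, smul_eq_mul, mul_right_comm, ← C_mul, inv_mul_cancel₀ hu0]
      simp)
    have := hcc 0 y b
    simp [hy, hb] at this
  have hone (x : bettiBasis β 0 →₀ MvPolynomial (Fin n) K) : x = Finsupp.single b₀ (x b₀) := by
    ext1 b
    simp [huniq b]
  let f (b : bettiBasis β 1) := d 0 (Finsupp.single b 1) b₀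
  have hf (x) : Finsupp.linearCombination _ f x = d 0 x b₀ := by
    induction x using Finsupp.induction_linear with
    | zero => simp
    | add x y hx hy => simp [hx, hy]
    | single b r =>
      rw [← mul_one r, ← smul_eq_mul, ← Finsupp.smul_single, map_smul, map_smul]
      simp [f]
  refine ⟨f, fun b => ?_, ?_, fun c hc b => ?_⟩
  · obtain h | ⟨-, h⟩ := hdeg 0 b b₀
    · simp only [f, h]
      exact isHomogeneous_zero _ _ _
    · simpa [f, hb₀deg] using h
  · ext r
    have hr : r ∈ I ↔ ε (Finsupp.single b₀ r) = 0 := by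
      rw [hε, Finsupp.linearCombination_single, Ideal.Quotient.eq_zero_iff_mem, hu, smul_eq_mul]
      exact (Ideal.mul_unit_mem_iff_mem _ ((IsUnit.mk0 u hu0).map C)).symm
    rw [hr, hker', Ideal.span, ← Finsupp.range_linearCombination, LinearMap.mem_range]
    refine exists_congr fun y => ?_
    rw [hf]
    refine ⟨fun h => h ▸ hone _, fun h => by simp [h]⟩
  · rw [hf] at hc
    have h0 : d 0 c = 0 := by rw [hone (d 0 c), hc, Finsupp.single_zero]
    obtain ⟨y, rfl⟩ := (hexact 0).le h0
    exact hcc 1 y b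

/-- First graded Betti numbers of an ideal generated by forms of a fixed positive degree `D`. -/
theorem IsMinimalFreeResolution.betti_one_eq {K : Type*} [Field K] {n D : ℕ} (hD : D ≠ 0)
    {G : Set (MvPolynomial (Fin n) K)} (hG : ∀ g ∈ G, g.IsHomogeneous D) {β : ℕ → ℕ → ℕ}
    (h : IsMinimalFreeResolution K (Ideal.span G) β) (j : ℕ) :
    β 1 j = if j = D then Module.finrank K (Submodule.span K G) else 0 := by
  obtain ⟨f, hf, hspan, hmin⟩ := h.exists_minimal_generators fun x hx => by
    have := homogeneousComponent_eq_zero_of_mem_span hG (Nat.pos_of_ne_zero hD) hx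
    rwa [homogeneousComponent_zero, C_eq_zero] at this
  obtain ⟨hdeg, hGf⟩ := degree_eq_and_span_eq_of_minimal hf hspan hG hmin
  split_ifs with hj
  · subst hj
    let e : Fin (β 1 j) ≃ bettiBasis β 1 :=
      { toFun := fun t => ⟨(j, t), t.2⟩
        invFun := fun b => ⟨b.1.2, hdeg b ▸ b.2⟩
        left_inv := fun t => rfl
        right_inv := fun b => Subtype.ext (Prod.ext (hdeg b).symm rfl) }
    have := finrank_span_eq_card ((linearIndependent_of_minimal hmin).comp e e.injective)
    rw [hGf, ← e.surjective.range_comp, this, Fintype.card_fin]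
  · by_contra h0
    exact hj (hdeg ⟨(j, 0), Nat.pos_of_ne_zero h0⟩)

section Vandermonde

variable (K : Type*) [Field K]

/-- The maximal minor of the Vandermonde matrix on the columns `v`, possibly with repetitions. -/
noncomputable def vandermondeMinor {n k : ℕ} (v : Fin (k + 1) → Fin n) : MvPolynomial (Fin n) K :=
  ((vandermondeMatrix K n k).submatrix id v).det

variable {K}

theorem vandermondeMinor_eq_det {n k : ℕ} (v : Fin (k + 1) → Fin n) :
    vandermondeMinor K v = (Matrix.vandermonde fun i => (X (v i) : MvPolynomial (Fin n) K)).det := by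
  rw [vandermondeMinor, ← Matrix.det_transpose]
  rfl

theorem vandermondeMinor_eq_zero {n k : ℕ} {v : Fin (k + 1) → Fin n} (hv : ¬ v.Injective) :
    vandermondeMinor K v = 0 := by
  rw [vandermondeMinor_eq_det, ← not_ne_iff, Matrix.det_vandermonde_ne_zero_iff]
  exact fun h => hv (h.of_comp (f := X))

theorem vandermondeMinor_isHomogeneous {n k : ℕ} (v : Fin (k + 1) → Fin n) :
    (vandermondeMinor K v).IsHomogeneous ((k + 1).choose 2) := by
  rw [vandermondeMinor, Matrix.det_apply']
  refine IsHomogeneous.sum _ _ _ fun s _ => ?_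
  rw [← zero_add ((k + 1).choose 2)]
  refine IsHomogeneous.mul (by simpa using isHomogeneous_C (Fin n) ((s.sign : ℤ) : K)) ?_
  have hsum : ∑ i : Fin (k + 1), ((s i : Fin (k + 1)) : ℕ) = (k + 1).choose 2 := by
    rw [Equiv.sum_comp s (fun i => (i : ℕ)), Fin.sum_univ_eq_sum_range (fun i => i),
      Finset.sum_range_id, Nat.choose_two_right]
  rw [← hsum]
  exact IsHomogeneous.prod _ _ _ fun i _ => isHomogeneous_X_pow _ _

theorem vandermondeMinor_mem_of_range_eq {n k : ℕ} {v w : Fin (k + 1) → Fin n}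
    (hv : v.Injective) (hw : w.Injective) (h : Set.range v = Set.range w)
    {W : Submodule K (MvPolynomial (Fin n) K)} (hW : vandermondeMinor K w ∈ W) :
    vandermondeMinor K v ∈ W := by
  let τ : Equiv.Perm (Fin (k + 1)) :=
    (Equiv.ofInjective v hv).trans ((Equiv.setCongr h).trans (Equiv.ofInjective w hw).symm)
  have hτ : v = w ∘ τ := by
    ext1 i
    simp [τ, Equiv.apply_ofInjective_symm]
  have : vandermondeMinor K v = (τ.sign : ℤ) • vandermondeMinor K w := by
    simpa [vandermondeMinor, hτ] using
      Matrix.det_permute' τ ((vandermondeMatrix K n k).submatrix id w)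
  rw [this]
  exact zsmul_mem hW _

/-- The alternating sum of all minors on `k + 1` of the `k + 2` columns `w` vanishes. -/
theorem sum_vandermondeMinor_succAbove {n k : ℕ} (w : Fin (k + 2) → Fin n) :
    ∑ i : Fin (k + 2), (-1) ^ (i : ℕ) * vandermondeMinor K (w ∘ i.succAbove) = 0 := by
  let r : Fin (k + 2) → Fin (k + 1) := Fin.cons 0 id
  have h0 : ((vandermondeMatrix K n k).submatrix r w).det = 0 :=
    Matrix.det_zero_of_row_eq (i := 0) (j := 1) (by simp) (by ext j; simp [r])
  rw [Matrix.det_succ_row_zero] at h0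
  rw [← h0]
  refine Finset.sum_congr rfl fun i _ => ?_
  simp [vandermondeMinor, vandermondeMatrix, r]

/-- The columns `0` and `t + 1` for `t ∈ T`. -/
def consColumns {N k : ℕ} (T : {T : Finset (Fin N) // T.card = k}) : Fin (k + 1) → Fin (N + 1) :=
  Fin.cons 0 fun i => (T.1.orderEmbOfFin T.2 i).succ

theorem consColumns_injective {N k : ℕ} (T : {T : Finset (Fin N) // T.card = k}) :
    (consColumns T).Injective := by
  rw [consColumns, Fin.cons_injective_iff]
  exact ⟨by simp [Fin.succ_ne_zero], (Fin.succ_injective _).comp (T.1.orderEmbOfFin T.2).injective⟩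

theorem vandermondeMinor_cons_mem {N k : ℕ} (v : Fin k → Fin (N + 1)) :
    vandermondeMinor K (Fin.cons 0 v : Fin (k + 1) → Fin (N + 1)) ∈
      Submodule.span K (Set.range fun T : {T : Finset (Fin N) // T.card = k} =>
        vandermondeMinor K (consColumns T)) := by
  by_cases hv : (Fin.cons 0 v : Fin (k + 1) → Fin (N + 1)).Injective
  swap
  · rw [vandermondeMinor_eq_zero hv]
    exact zero_mem _
  obtain ⟨h0, hinj⟩ := Fin.cons_injective_iff.mp hv
  have hex (i) : ∃ u : Fin N, u.succ = v i :=
    Fin.exists_succ_eq.mpr fun h => h0 ⟨i, h⟩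
  choose u hu using hex
  have hu' : u.Injective := fun i j h => hinj (by rw [← hu, ← hu, h])
  let T : {T : Finset (Fin N) // T.card = k} :=
    ⟨Finset.univ.map ⟨u, hu'⟩, by simp⟩
  refine vandermondeMinor_mem_of_range_eq hv (consColumns_injective T) ?_
    (Submodule.subset_span ⟨T, rfl⟩)
  have hv' : v = Fin.succ ∘ u := funext fun i => (hu i).symm
  have : (fun i => (T.1.orderEmbOfFin T.2 i).succ) = Fin.succ ∘ T.1.orderEmbOfFin T.2 := rfl
  rw [consColumns, Fin.range_cons, Fin.range_cons, this, hv', Set.range_comp, Set.range_comp,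
    Finset.range_orderEmbOfFin]
  simp [T]

theorem vandermondeMinor_mem {N k : ℕ} (v : Fin (k + 1) → Fin (N + 1)) :
    vandermondeMinor K v ∈
      Submodule.span K (Set.range fun T : {T : Finset (Fin N) // T.card = k} =>
        vandermondeMinor K (consColumns T)) := by
  have h := sum_vandermondeMinor_succAbove (K := K) (Fin.cons 0 v : Fin (k + 2) → Fin (N + 1))
  rw [Fin.sum_univ_succ] at h
  have hv : (Fin.cons 0 v : Fin (k + 2) → Fin (N + 1)) ∘ Fin.succAbove 0 = v := by
    ext1 i
    simp
  rw [hv, Fin.val_zero, pow_zero, one_mul] at h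
  rw [eq_neg_of_add_eq_zero_left h]
  refine neg_mem (sum_mem fun i _ => ?_)
  have hi : (Fin.cons 0 v : Fin (k + 2) → Fin (N + 1)) ∘ i.succ.succAbove =
      Fin.cons 0 (v ∘ i.succAbove) := by
    ext1 j
    refine Fin.cases ?_ (fun j => ?_) j <;> simp
  have hpow : ((-1) ^ (i.succ : ℕ) : MvPolynomial (Fin (N + 1)) K) =
      C ((-1) ^ (i.succ : ℕ)) := by simp
  rw [hi, hpow, ← smul_eq_C_mul]
  exact Submodule.smul_mem _ _ (vandermondeMinor_cons_mem _)

theorem linearIndependent_vandermondeMinor (N k : ℕ) :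
    LinearIndependent K fun T : {T : Finset (Fin N) // T.card = k} =>
      vandermondeMinor K (consColumns T) := by
  classical
  let x (T : {T : Finset (Fin N) // T.card = k}) : Fin (N + 1) → MvPolynomial (Fin N) K :=
    Fin.cons 0 fun t => if t ∈ T.1 then X t else 0
  have hx (T T' : {T : Finset (Fin N) // T.card = k}) :
      aeval (x T) (vandermondeMinor K (consColumns T')) ≠ 0 ↔
        (x T ∘ consColumns T').Injective := by
    have : aeval (x T) (vandermondeMinor K (consColumns T')) =
        (Matrix.vandermonde (x T ∘ consColumns T')).det := by
      rw [vandermondeMinor_eq_det, AlgHom.map_det]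
      congr 1
      ext1 i j
      simp [Matrix.vandermonde_apply]
    rw [this, Matrix.det_vandermonde_ne_zero_iff]
  rw [linearIndependent_iff']
  intro s c hc T hT
  have := congrArg (aeval (x T)) hc
  rw [map_sum, Finset.sum_eq_single T, map_smul, map_zero, smul_eq_zero] at this
  · refine this.resolve_right ((hx T T).mpr ?_)
    have hcomp : x T ∘ consColumns T = Fin.cons 0 fun i => X (T.1.orderEmbOfFin T.2 i) := by
      ext1 i
      refine Fin.cases ?_ (fun i => ?_) i <;> simp [x, consColumns]
    rw [hcomp, Fin.cons_injective_iff]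
    exact ⟨by simp, (X_injective (R := K)).comp (T.1.orderEmbOfFin T.2).injective⟩
  · intro T' _ hne
    rw [map_smul]
    obtain ⟨t, ht, htT⟩ : ∃ t ∈ T'.1, t ∉ T.1 := by
      by_contra! hsub
      exact hne (Subtype.ext (Finset.eq_of_subset_of_card_le hsub (T.2.trans T'.2.symm).le))
    obtain ⟨i, rfl⟩ : t ∈ Set.range (T'.1.orderEmbOfFin T'.2) := by
      rwa [Finset.range_orderEmbOfFin]
    have : aeval (x T) (vandermondeMinor K (consColumns T')) = 0 := by
      by_contra h0
      have := (hx T T').mp h0 (a₁ := 0) (a₂ := i.succ) (by simp [x, consColumns, htT])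
      exact Fin.succ_ne_zero i this.symm
    rw [this, smul_zero]
  · exact fun h => absurd hT h

theorem finrank_span_vandermondeMinor (N k : ℕ) :
    Module.finrank K (Submodule.span K {d | ∃ g : Fin (k + 1) ↪ Fin (N + 1),
      d = ((vandermondeMatrix K (N + 1) k).submatrix id g).det}) = N.choose k := by
  have : Submodule.span K {d | ∃ g : Fin (k + 1) ↪ Fin (N + 1),
      d = ((vandermondeMatrix K (N + 1) k).submatrix id g).det} =
      Submodule.span K (Set.range fun T : {T : Finset (Fin N) // T.card = k} =>
        vandermondeMinor K (consColumns T)) := by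
    refine le_antisymm (Submodule.span_le.mpr ?_) (Submodule.span_mono ?_)
    · rintro _ ⟨g, rfl⟩
      exact vandermondeMinor_mem g
    · rintro _ ⟨T, rfl⟩
      exact ⟨⟨_, consColumns_injective T⟩, rfl⟩
  rw [this, finrank_span_eq_card (linearIndependent_vandermondeMinor N k),
    Fintype.card_finset_len, Fintype.card_fin]

end Vandermonde

theorem vanIdeal_betti_one {K : Type*} [Field K] {N k : ℕ} (hk : k ≠ 0) {β : ℕ → ℕ → ℕ}
    (h : IsMinimalFreeResolution K (vanIdeal K (N + 1) k) β) (j : ℕ) :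
    β 1 j = if j = (k + 1).choose 2 then N.choose k else 0 := by
  rw [← finrank_span_vandermondeMinor (K := K) N k]
  refine IsMinimalFreeResolution.betti_one_eq (Nat.choose_pos (by omega)).ne' ?_ h j
  rintro _ ⟨g, rfl⟩
  exact vandermondeMinor_isHomogeneous g

/-- The recursion for the first graded Betti numbers
`β_{1,j}(R/I_{n,k}) = β_{1,j-k}(R'/I_{n-1,k-1}) + β_{1,j}(R'/I_{n-1,k})`
for `n - 1 > k ≥ 2` (where `β_{1,j-k} = 0` if `j - k < 0`). -/
theorem vanIdeal_betti_recursion_one (K : Type*) [Field K] (n k : ℕ)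
    (hk : 2 ≤ k) (hn : k < n - 1) (β β' β'' : ℕ → ℕ → ℕ)
    (hβ : IsMinimalFreeResolution K (vanIdeal K n k) β)
    (hβ' : IsMinimalFreeResolution K (vanIdeal K (n - 1) (k - 1)) β')
    (hβ'' : IsMinimalFreeResolution K (vanIdeal K (n - 1) k) β'')
    (j : ℕ) :
    β 1 j = (if k ≤ j then β' 1 (j - k) else 0) + β'' 1 j := by
  obtain ⟨N, rfl⟩ : ∃ N, n = N + 2 := ⟨n - 2, by omega⟩
  obtain ⟨k, rfl⟩ : ∃ l, k = l + 1 := ⟨k - 1, by omega⟩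
  rw [vanIdeal_betti_one (by omega) hβ, vanIdeal_betti_one (N := N) (by omega) hβ',
    vanIdeal_betti_one (N := N) (by omega) hβ'']
  have hchoose : (k + 1 + 1).choose 2 = (k + 1) + (k + 1).choose 2 := by
    rw [Nat.choose_succ_succ' (k + 1) 1, Nat.choose_one_right]
  rw [Nat.add_sub_cancel, hchoose, Nat.choose_succ_succ' N k]
  split_ifs <;> omega
end
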